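/- arXiv:1406.4380 — 4 statements merged into one kernel-verified Lean document; each statement's English description precedes it below -/
import Mathlib

section
/- Every graph G with maximum degree Δ ≥ 24 satisfies χ_a(G) < min{ (3/2)·Δ^(4/3) + 5Δ − 14 , (3/2)·Δ^(4/3) + Δ + 8·Δ^(4/3)/(Δ^(2/3) − 4) + 1 }, where χ_a(G) is the acyclic chromatic number of G. -/
/-- A coloring is an acyclic coloring of `G` if it is proper and every cycle of `G`
receives at least 3 distinct colors (i.e. no cycle is colored with only two colors). -/
def IsAcyclicColoring {V : Type} (G : SimpleGraph V) {α : Type} [DecidableEq α]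
    (c : V → α) : Prop :=
  (∀ u v, G.Adj u v → c u ≠ c v) ∧
  ∀ (v : V) (w : G.Walk v v), w.IsCycle → 3 ≤ (w.support.map c).toFinset.card

/-- The acyclic chromatic number: the least `k` such that `G` has an acyclic coloring
with `k` colors. -/
noncomputable def acyclicChromaticNumber {V : Type} (G : SimpleGraph V) : ℕ :=
  sInf {k | ∃ c : V → Fin k, IsAcyclicColoring G c}

/-- `c` takes equal values at entries of the list two positions apart. -/
def Alternates {V α : Type} (c : V → α) : List V → Prop
  | a :: b :: d :: t => c a = c d ∧ Alternates c (b :: d :: t)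
  | _ => True

theorem Alternates.eqOn {V α : Type} {c c' : V → α} :
    ∀ {l : List V}, Alternates c l → Alternates c' l →
      (∀ x ∈ l, x ∉ l.drop 2 → c x = c' x) → l.Nodup → ∀ x ∈ l, c x = c' x
  | [], _, _, _, _ => by simp
  | [a], _, _, h, _ => by simpa using h
  | [a, b], _, _, h, _ => by simpa using h
  | a :: b :: d :: t, h, h', hl, hn => by
    have ha : c a = c' a := hl a (by simp) (by simp_all)
    have hb : c b = c' b := hl b (by simp) (by simp_all)
    have hd : c d = c' d := by rw [← h.1, ← h'.1, ha]
    have key := Alternates.eqOn (l := b :: d :: t) h.2 h'.2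
      (by
        intro x hx hxt
        simp only [List.drop_succ_cons, List.drop_zero] at hxt
        simp only [List.mem_cons, hxt, or_false] at hx
        rcases hx with rfl | rfl <;> assumption)
      hn.of_cons
    intro x hx
    rcases List.mem_cons.1 hx with rfl | hx
    · exact ha
    · exact key x hx

section Counting

variable {V α : Type} [Fintype V] [DecidableEq V] [Fintype α] [DecidableEq α]

open Classical in
/-- The colorings satisfying `P X`, normalized to be constant outside `X`. -/
noncomputable def colorings (P : Finset V → (V → α) → Prop) (a₀ : α) (X : Finset V) :
    Finset (V → α) :=
  {c | P X c ∧ ∀ x ∉ X, c x = a₀}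

variable {P : Finset V → (V → α) → Prop} {a₀ : α}

theorem card_le_card_colorings_sdiff
    (mono : ∀ X Y c, Y ⊆ X → P X c → P Y c)
    (local_ : ∀ X c c', (∀ x ∈ X, c x = c' x) → P X c → P X c')
    {X R : Finset V} {v : V} (hv : v ∈ R) (E : Finset (V → α))
    (hE : ∀ c ∈ E, P (X.erase v) c ∧ ∀ x ∉ X, c x = a₀)
    (hinj : ∀ c ∈ E, ∀ c' ∈ E, (∀ x ∉ R, c x = c' x) → ∀ x ∈ R, c x = c' x) :
    E.card ≤ (colorings P a₀ (X \ R)).card := by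
  refine Finset.card_le_card_of_injOn (fun c x => if x ∈ R then a₀ else c x) ?_ ?_
  · intro c hc
    obtain ⟨h1, h2⟩ := hE c hc
    simp only [colorings, Finset.coe_filter, Finset.mem_univ, true_and, Set.mem_ofPred_eq]
    refine ⟨local_ _ c _ ?_ (mono _ _ c ?_ h1), ?_⟩
    · intro x hx
      simp [(Finset.mem_sdiff.1 hx).2]
    · intro x hx
      rw [Finset.mem_sdiff] at hx
      exact Finset.mem_erase.2 ⟨fun h => hx.2 (h ▸ hv), hx.1⟩
    · intro x hx
      by_cases hxR : x ∈ R
      · simp [hxR]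
      · simp only [hxR, if_false]
        exact h2 x fun hX => hx (Finset.mem_sdiff.2 ⟨hX, hxR⟩)
  · intro c hc c' hc' h
    have off : ∀ x ∉ R, c x = c' x := fun x hx => by simpa [hx] using congrFun h x
    funext x
    by_cases hx : x ∈ R
    · exact hinj c hc c' hc' off x hx
    · exact off x hx

open Classical in
/-- The colorings obtained from colorings of `X.erase v` by giving `v` an arbitrary color. -/
noncomputable def extensions (P : Finset V → (V → α) → Prop) (a₀ : α) (X : Finset V) (v : V) :
    Finset (V → α) :=
  {c | P (X.erase v) c ∧ ∀ x ∉ X, c x = a₀}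

theorem card_extensions
    (local_ : ∀ X c c', (∀ x ∈ X, c x = c' x) → P X c → P X c')
    {X : Finset V} {v : V} (hv : v ∈ X) :
    Fintype.card α * (colorings P a₀ (X.erase v)).card ≤ (extensions P a₀ X v).card := by
  rw [← Finset.card_univ, ← Finset.card_product]
  refine Finset.card_le_card_of_injOn (fun p => Function.update p.2 v p.1) ?_ ?_
  · rintro ⟨a, c⟩ hc
    simp only [colorings, Finset.coe_product, Finset.coe_univ, Finset.coe_filter,
      Finset.mem_univ, true_and, Set.mem_prod, Set.mem_univ, Set.mem_ofPred_eq] at hc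
    simp only [extensions, Finset.coe_filter, Finset.mem_univ, true_and, Set.mem_ofPred_eq]
    refine ⟨local_ _ c _ (fun x hx => ?_) hc.1, fun x hx => ?_⟩
    · rw [Function.update_of_ne (Finset.ne_of_mem_erase hx)]
    · rw [Function.update_of_ne (by rintro rfl; exact hx hv)]
      exact hc.2 x fun h => hx (Finset.mem_of_mem_erase h)
  · rintro ⟨a, c⟩ hc ⟨a', c'⟩ hc' h
    simp only [colorings, Finset.coe_product, Finset.coe_univ, Finset.coe_filter,
      Finset.mem_univ, true_and, Set.mem_prod, Set.mem_univ, Set.mem_ofPred_eq] at hc hc'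
    have ha : a = a' := by simpa using congrFun h v
    refine Prod.ext ha (funext fun x => ?_)
    by_cases hx : x = v
    · subst hx
      simp [hc.2 x (by simp), hc'.2 x (by simp)]
    · simpa [hx] using congrFun h x

/-- The event that `c` alternates along the path `l` of `X` going through `v`, where `v` is not
among the first two vertices of `l`. -/
def AlternatesThrough (X : Finset V) (v : V) (c : V → α) (l : List V) : Prop :=
  l.Nodup ∧ (∀ x ∈ l, x ∈ X) ∧ v ∈ l.drop 2 ∧ Alternates c l

theorem colorings_sdiff_mul_pow_le {β : ℝ} (hβ : 0 < β) {X : Finset V}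
    (H : ∀ Y ⊆ X, ∀ v ∈ Y,
      β * (colorings P a₀ (Y.erase v)).card ≤ (colorings P a₀ Y).card)
    (R : Finset V) (hR : R ⊆ X) :
    (colorings P a₀ (X \ R)).card * β ^ R.card ≤ (colorings P a₀ X).card := by
  induction R using Finset.induction_on with
  | empty => simp
  | insert a R ha ih =>
    have h1 := H (X \ R) Finset.sdiff_subset a
      (Finset.mem_sdiff.2 ⟨hR (Finset.mem_insert_self a R), ha⟩)
    have h2 := ih fun x hx => hR (Finset.mem_insert_of_mem hx)
    rw [Finset.card_insert_of_notMem ha, Finset.sdiff_insert, pow_succ]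
    calc _ = (β * ((colorings P a₀ ((X \ R).erase a)).card : ℝ)) * β ^ R.card := by ring
      _ ≤ (colorings P a₀ (X \ R)).card * β ^ R.card := by gcongr
      _ ≤ _ := h2

theorem card_colorings_erase_le
    (mono : ∀ X Y c, Y ⊆ X → P X c → P Y c)
    (local_ : ∀ X c c', (∀ x ∈ X, c x = c' x) → P X c → P X c')
    {β : ℝ} (hβ : 0 < β) (J : ℕ) (F : V → Finset V) (T : V → ℕ → Finset (List V))
    (hT : ∀ v i, ∀ l ∈ T v i, l.length = 2 * i + 4)
    (hbad : ∀ X v c, v ∈ X → P (X.erase v) c → ¬ P X c →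
      (∃ y ∈ F v, y ≠ v ∧ c v = c y) ∨
      ∃ i < J, ∃ l ∈ T v i, ∃ l' ∈ T v i, l ≠ l' ∧
        AlternatesThrough X v c l ∧ AlternatesThrough X v c l')
    (hcard : ∀ v, β + (F v).card + (∑ i ∈ Finset.range J, (T v i).card * β⁻¹ ^ (2 * i + 1)) / 2
      ≤ Fintype.card α) (X : Finset V) :
    ∀ v ∈ X, β * (colorings P a₀ (X.erase v)).card ≤ (colorings P a₀ X).card := by
  classical
  induction X using Finset.strongInduction with
  | H X IH =>
  intro v hv
  set N : ℝ := ((colorings P a₀ (X.erase v)).card : ℝ) with hN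
  set A := extensions P a₀ X v with hA
  have IH' : ∀ Y ⊆ X.erase v, ∀ w ∈ Y,
      β * (colorings P a₀ (Y.erase w)).card ≤ (colorings P a₀ Y).card := fun Y hY w hw =>
    IH Y (Finset.ssubset_of_subset_of_ssubset hY (Finset.erase_ssubset hv)) w hw
  have hF : ∀ y, y ≠ v → ((A.filter fun c => c v = c y).card : ℝ) ≤ N := by
    intro y hy
    rw [hN, Finset.erase_eq]
    refine mod_cast card_le_card_colorings_sdiff mono local_ (Finset.mem_singleton_self v) _ ?_ ?_
    · intro c hc
      simpa [A, extensions] using (Finset.mem_filter.1 hc).1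
    · intro c hc c' hc' h x hx
      rw [Finset.mem_singleton.1 hx, (Finset.mem_filter.1 hc).2, (Finset.mem_filter.1 hc').2]
      exact h y (by simpa using hy)
  have hE : ∀ i, ∀ l ∈ T v i,
      ((A.filter fun c => AlternatesThrough X v c l).card : ℝ) ≤ N * β⁻¹ ^ (2 * i + 1) := by
    intro i l hl
    by_cases hne : (A.filter fun c => AlternatesThrough X v c l).Nonempty
    swap
    · rw [Finset.not_nonempty_iff_eq_empty.1 hne]
      simp only [Finset.card_empty, Nat.cast_zero]
      positivity
    obtain ⟨c₀, hc₀⟩ := hne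
    obtain ⟨hnd, hX, hvl, -⟩ := (Finset.mem_filter.1 hc₀).2
    set R := (l.drop 2).toFinset with hR
    have hvR : v ∈ R := List.mem_toFinset.2 hvl
    have hRX : R ⊆ X := fun x hx => hX x (List.mem_of_mem_drop (List.mem_toFinset.1 hx))
    have h1 : (A.filter fun c => AlternatesThrough X v c l).card ≤
        (colorings P a₀ (X \ R)).card := by
      refine card_le_card_colorings_sdiff mono local_ hvR _ ?_ ?_
      · intro c hc
        simpa [A, extensions] using (Finset.mem_filter.1 hc).1
      · intro c hc c' hc' h x hx
        refine Alternates.eqOn (Finset.mem_filter.1 hc).2.2.2.2 (Finset.mem_filter.1 hc').2.2.2.2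
          (fun x _ hx' => h x fun hxR => hx' (List.mem_toFinset.1 hxR)) hnd x
          (List.mem_of_mem_drop (List.mem_toFinset.1 hx))
    have hcardR : (R.erase v).card = 2 * i + 1 := by
      rw [Finset.card_erase_of_mem hvR, hR,
        List.toFinset_card_of_nodup (hnd.sublist (List.drop_sublist 2 l)), List.length_drop,
        hT v i l hl]
      omega
    have h2 := colorings_sdiff_mul_pow_le hβ IH' (R.erase v) (Finset.erase_subset_erase v hRX)
    have h3 : X.erase v \ R.erase v = X \ R := by
      ext x
      simp only [Finset.mem_sdiff, Finset.mem_erase]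
      constructor
      · rintro ⟨⟨h, h'⟩, h''⟩
        exact ⟨h', fun hx => h'' ⟨h, hx⟩⟩
      · rintro ⟨h, h'⟩
        exact ⟨⟨fun e => h' (e ▸ hvR), h⟩, fun hx => h' hx.2⟩
    rw [h3, hcardR] at h2
    rw [inv_pow, ← div_eq_mul_inv, le_div_iff₀ (by positivity)]
    refine le_trans ?_ h2
    gcongr
  set BF := (F v).biUnion fun y => if y = v then ∅ else A.filter fun c => c v = c y with hBF
  set BT := A.filter fun c => ∃ i < J, ∃ l ∈ T v i, ∃ l' ∈ T v i, l ≠ l' ∧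
        AlternatesThrough X v c l ∧ AlternatesThrough X v c l' with hBT
  have hcover : A ⊆ colorings P a₀ X ∪ BF ∪ BT := by
    intro c hc
    have hc' : P (X.erase v) c ∧ ∀ x ∉ X, c x = a₀ := by simpa [A, extensions] using hc
    by_cases hP : P X c
    · exact Finset.mem_union_left _ (Finset.mem_union_left _ (by simpa [colorings, hP] using hc'.2))
    · rcases hbad X v c hv hc'.1 hP with ⟨y, hy, hyv, hcy⟩ | h
      · refine Finset.mem_union_left _ (Finset.mem_union_right _ ?_)
        rw [hBF, Finset.mem_biUnion]
        exact ⟨y, hy, by simp [hyv, hc, hcy]⟩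
      · exact Finset.mem_union_right _ (Finset.mem_filter.2 ⟨hc, h⟩)
  have hcov : (A.card : ℝ) ≤ (colorings P a₀ X).card + BF.card + BT.card := by
    exact_mod_cast (Finset.card_le_card hcover).trans ((Finset.card_union_le _ _).trans
      (Nat.add_le_add_right (Finset.card_union_le _ _) _))
  have hBFcard : (BF.card : ℝ) ≤ (F v).card * N := by
    calc (BF.card : ℝ) ≤ ∑ y ∈ F v,
          ((if y = v then ∅ else A.filter fun c => c v = c y : Finset (V → α)).card : ℝ) := by
          exact_mod_cast Finset.card_biUnion_le
      _ ≤ ∑ y ∈ F v, N := by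
          refine Finset.sum_le_sum fun y _ => ?_
          split_ifs with h
          · simp [hN]
          · exact hF y h
      _ = _ := by simp
  have hBTcard : (2 : ℝ) * BT.card ≤
      ∑ i ∈ Finset.range J, ((T v i).card * β⁻¹ ^ (2 * i + 1)) * N := by
    have hnat : BT.card * 2 ≤ ∑ i ∈ Finset.range J, ∑ l ∈ T v i,
        (A.filter fun c => AlternatesThrough X v c l).card := by
      rw [← smul_eq_mul]
      have : ∑ i ∈ Finset.range J, ∑ l ∈ T v i,
          (A.filter fun c => AlternatesThrough X v c l).card = ∑ c ∈ A,
            ∑ i ∈ Finset.range J, ((T v i).filter fun l => AlternatesThrough X v c l).card := by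
        rw [Finset.sum_comm]
        refine Finset.sum_congr rfl fun i _ => ?_
        simp_rw [Finset.card_filter]
        rw [Finset.sum_comm]
      rw [this]
      refine le_trans ?_ (Finset.sum_le_sum_of_subset
        (show BT ⊆ A from Finset.filter_subset _ _))
      refine Finset.card_nsmul_le_sum _ _ _ fun c hc => ?_
      obtain ⟨i, hi, l, hl, l', hl', hne, h, h'⟩ := (Finset.mem_filter.1 hc).2
      refine le_trans ?_ (Finset.single_le_sum
        (f := fun i => ((T v i).filter fun l => AlternatesThrough X v c l).card)
        (fun _ _ => Nat.zero_le _) (Finset.mem_range.2 hi))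
      exact Finset.one_lt_card.2 ⟨l, by simp [hl, h], l', by simp [hl', h'], hne⟩
    calc (2 : ℝ) * BT.card = ((BT.card * 2 : ℕ) : ℝ) := by push_cast; ring
      _ ≤ ((∑ i ∈ Finset.range J, ∑ l ∈ T v i,
        (A.filter fun c => AlternatesThrough X v c l).card : ℕ) : ℝ) := mod_cast hnat
      _ ≤ _ := by
        push_cast
        refine Finset.sum_le_sum fun i _ => ?_
        refine (Finset.sum_le_sum (hE i)).trans (le_of_eq ?_)
        simp only [Finset.sum_const, nsmul_eq_mul]
        ring
  rw [← Finset.sum_mul] at hBTcard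
  have hAcard : Fintype.card α * N ≤ A.card := by
    rw [hN, hA]
    exact_mod_cast card_extensions (a₀ := a₀) local_ hv
  have hfin := mul_le_mul_of_nonneg_right (hcard v) (Nat.cast_nonneg _ : 0 ≤ N)
  nlinarith

/-- A local-lemma type criterion: if a partial coloring can only fail at a new vertex `v` by a
repetition on `F v` or by alternating along two of the paths in `T v`, and there are enough
colors, then a full coloring exists. -/
theorem exists_coloring_of_weight_le [Nonempty α]
    (mono : ∀ X Y c, Y ⊆ X → P X c → P Y c)
    (local_ : ∀ X c c', (∀ x ∈ X, c x = c' x) → P X c → P X c')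
    (hempty : ∀ c, P ∅ c)
    {β : ℝ} (hβ : 0 < β) (J : ℕ) (F : V → Finset V) (T : V → ℕ → Finset (List V))
    (hT : ∀ v i, ∀ l ∈ T v i, l.length = 2 * i + 4)
    (hbad : ∀ X v c, v ∈ X → P (X.erase v) c → ¬ P X c →
      (∃ y ∈ F v, y ≠ v ∧ c v = c y) ∨
      ∃ i < J, ∃ l ∈ T v i, ∃ l' ∈ T v i, l ≠ l' ∧
        AlternatesThrough X v c l ∧ AlternatesThrough X v c l')
    (hcard : ∀ v, β + (F v).card + (∑ i ∈ Finset.range J, (T v i).card * β⁻¹ ^ (2 * i + 1)) / 2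
      ≤ Fintype.card α) :
    ∃ c, P Finset.univ c := by
  obtain ⟨a₀⟩ := ‹Nonempty α›
  have h := colorings_sdiff_mul_pow_le (a₀ := a₀) hβ (X := Finset.univ)
    (fun Y _ => card_colorings_erase_le mono local_ hβ J F T hT hbad hcard Y)
    Finset.univ subset_rfl
  have h0 : 0 < (colorings P a₀ (Finset.univ \ Finset.univ : Finset V)).card :=
    Finset.card_pos.2 ⟨fun _ => a₀, by simp [colorings, hempty]⟩
  have h1 : (0 : ℝ) < (colorings P a₀ Finset.univ).card := lt_of_lt_of_le (by positivity) h
  obtain ⟨c, hc⟩ := Finset.card_pos.1 (Nat.cast_pos.1 h1)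
  simp only [colorings, Finset.mem_filter] at hc
  exact ⟨c, hc.2.1⟩

end Counting

section Graph

variable {V : Type} (G : SimpleGraph V)

/-- The list `[g m, …, g 1, g 0]`. -/
def pathList (g : ℕ → V) : ℕ → List V
  | 0 => [g 0]
  | m + 1 => g (m + 1) :: pathList g m

theorem mem_pathList {g : ℕ → V} {m : ℕ} {x : V} : x ∈ pathList g m ↔ ∃ i ≤ m, g i = x := by
  induction m with
  | zero => simp [pathList, eq_comm]
  | succ m ih =>
    simp only [pathList, List.mem_cons, ih]
    constructor
    · rintro (rfl | ⟨i, hi, rfl⟩)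
      · exact ⟨m + 1, le_rfl, rfl⟩
      · exact ⟨i, by omega, rfl⟩
    · rintro ⟨i, hi, rfl⟩
      rcases Nat.lt_or_ge m i with h | h
      · left
        rw [show i = m + 1 by omega]
      · exact Or.inr ⟨i, h, rfl⟩

theorem nodup_pathList {g : ℕ → V} {m : ℕ} (h : ∀ i ≤ m, ∀ j ≤ m, g i = g j → i = j) :
    (pathList g m).Nodup := by
  induction m with
  | zero => simp [pathList]
  | succ m ih =>
    rw [pathList, List.nodup_cons, mem_pathList]
    refine ⟨?_, ih fun i hi j hj => h i (by omega) j (by omega)⟩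
    rintro ⟨i, hi, hgi⟩
    have := h i (by omega) (m + 1) le_rfl hgi
    omega

theorem alternates_pathList {α : Type} {c : V → α} {g : ℕ → V} {m : ℕ}
    (h : ∀ i, i + 2 ≤ m → c (g i) = c (g (i + 2))) : Alternates c (pathList g m) := by
  induction m with
  | zero => simp [pathList, Alternates]
  | succ m ih =>
    cases m with
    | zero => simp [pathList, Alternates]
    | succ m =>
      have := ih fun i hi => h i (by omega)
      cases m with
      | zero => exact ⟨(h 0 (by omega)).symm, this⟩
      | succ m => exact ⟨(h (m + 1) (by omega)).symm, this⟩

theorem eq_of_pathList_eq {g h : ℕ → V} {m : ℕ} (e : pathList g m = pathList h m) :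
    ∀ i ≤ m, g i = h i := by
  induction m with
  | zero =>
    intro i hi
    obtain rfl : i = 0 := by omega
    simpa [pathList] using e
  | succ m ih =>
    intro i hi
    simp only [pathList, List.cons.injEq] at e
    rcases Nat.lt_or_ge m i with h | h
    · rw [show i = m + 1 by omega, e.1]
    · exact ih e.2 i h

theorem mem_drop_two_pathList {g : ℕ → V} {m i : ℕ} (h : i + 2 ≤ m) :
    g i ∈ (pathList g m).drop 2 := by
  obtain ⟨k, rfl⟩ : ∃ k, m = k + 2 := ⟨m - 2, by omega⟩
  simp only [pathList, List.drop_succ_cons, List.drop_zero]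
  exact mem_pathList.2 ⟨i, by omega, rfl⟩

/-- `g` runs once around a cycle of length `n` of `G` in `X`, which `c` colors alternately. -/
structure IsTwoColoredCycle {α : Type} (c : V → α) (X : Finset V) (g : ℕ → V) (n : ℕ) : Prop where
  three_le : 3 ≤ n
  closed : g n = g 0
  adj : ∀ i < n, G.Adj (g i) (g (i + 1))
  inj : ∀ i < n, ∀ j < n, g i = g j → i = j
  mem : ∀ i ≤ n, g i ∈ X
  ne : ∀ i < n, c (g i) ≠ c (g (i + 1))
  alt : ∀ i, i + 2 ≤ n → c (g i) = c (g (i + 2))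

namespace IsTwoColoredCycle

variable {G} {α : Type} {c : V → α} {X : Finset V} {g : ℕ → V} {n : ℕ}

theorem reverse (h : IsTwoColoredCycle G c X g n) :
    IsTwoColoredCycle G c X (fun i => g (n - i)) n where
  three_le := h.three_le
  closed := by simp [h.closed]
  adj i hi := by
    have := (h.adj (n - (i + 1)) (by omega)).symm
    rwa [show n - (i + 1) + 1 = n - i by omega] at this
  inj i hi j hj e := by
    have key : ∀ i < n, g (n - i) = g (if i = 0 then 0 else n - i) := by
      intro i hi
      split_ifs with h0
      · subst h0
        simpa using h.closed
      · rfl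
    rw [key i hi, key j hj] at e
    have := h.inj _ (by split_ifs <;> omega) _ (by split_ifs <;> omega) e
    split_ifs at this <;> omega
  mem i _ := h.mem _ (by omega)
  ne i hi := by
    have := (h.ne (n - (i + 1)) (by omega)).symm
    rwa [show n - (i + 1) + 1 = n - i by omega] at this
  alt i hi := by
    have := (h.alt (n - (i + 2)) (by omega)).symm
    rwa [show n - (i + 2) + 2 = n - i by omega] at this

theorem color_even (h : IsTwoColoredCycle G c X g n) (i : ℕ) (hi : 2 * i ≤ n) :
    c (g (2 * i)) = c (g 0) := by
  induction i with
  | zero => rfl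
  | succ i ih => rw [← ih (by omega), h.alt (2 * i) (by omega)]; rfl

theorem color_odd (h : IsTwoColoredCycle G c X g n) (i : ℕ) (hi : 2 * i + 1 ≤ n) :
    c (g (2 * i + 1)) = c (g 1) := by
  induction i with
  | zero => rfl
  | succ i ih => rw [← ih (by omega), h.alt (2 * i + 1) (by omega)]; rfl

theorem exists_length_eq (h : IsTwoColoredCycle G c X g n) : ∃ i, n = 2 * i + 4 := by
  have h3 := h.three_le
  rcases Nat.even_or_odd' n with ⟨k, hk | hk⟩
  · exact ⟨k - 2, by omega⟩
  · have h1 := h.color_odd k (by omega)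
    rw [← hk, h.closed] at h1
    exact absurd h1 (h.ne 0 (by omega))

theorem length_le [Fintype V] (h : IsTwoColoredCycle G c X g n) : n ≤ Fintype.card V := by
  have := Finset.card_le_card_of_injOn (s := Finset.range n) (t := Finset.univ) g (by simp)
    (fun i hi j hj e => h.inj i (by simpa using hi) j (by simpa using hj) e)
  simpa using this

theorem alternatesThrough_pathList (h : IsTwoColoredCycle G c X g n) (h4 : 4 ≤ n) :
    AlternatesThrough X (g 0) c (pathList g (n - 1)) := by
  refine ⟨nodup_pathList fun i hi j hj => h.inj i (by omega) j (by omega), ?_,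
    mem_drop_two_pathList (by omega), alternates_pathList fun i hi => h.alt i (by omega)⟩
  intro x hx
  obtain ⟨i, hi, rfl⟩ := mem_pathList.1 hx
  exact h.mem i (by omega)

end IsTwoColoredCycle

/-- The sequence `g (n - 1), g 0, g 1, …`. -/
def shiftedCycle (g : ℕ → V) (n : ℕ) : ℕ → V
  | 0 => g (n - 1)
  | i + 1 => g i

namespace IsTwoColoredCycle

variable {G} {α : Type} {c : V → α} {X : Finset V} {g : ℕ → V} {n : ℕ}

theorem alternatesThrough_shiftedCycle (h : IsTwoColoredCycle G c X g n) (h6 : 6 ≤ n) :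
    AlternatesThrough X (g 0) c (pathList (shiftedCycle g n) 5) := by
  refine ⟨nodup_pathList ?_, ?_, mem_drop_two_pathList (g := shiftedCycle g n) (i := 1) (by omega),
    alternates_pathList ?_⟩
  · have key : ∀ i ≤ 5, shiftedCycle g n i = g (if i = 0 then n - 1 else i - 1) := by
      rintro (_ | i) _ <;> simp [shiftedCycle]
    intro i hi j hj e
    rw [key i hi, key j hj] at e
    have := h.inj _ (by split_ifs <;> omega) _ (by split_ifs <;> omega) e
    split_ifs at this <;> omega
  · intro x hx
    obtain ⟨i, hi, rfl⟩ := mem_pathList.1 hx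
    cases i with
    | zero => exact h.mem _ (by omega)
    | succ i => exact h.mem _ (by omega)
  · intro i hi
    cases i with
    | zero =>
      obtain ⟨k, hk⟩ := h.exists_length_eq
      have := h.color_odd (k + 1) (by omega)
      rwa [show 2 * (k + 1) + 1 = n - 1 by omega] at this
    | succ i => exact h.alt i (by omega)

theorem of_walk {α : Type} [DecidableEq α] {c : V → α} {X : Finset V}
    (hproper : ∀ u ∈ X, ∀ v ∈ X, G.Adj u v → c u ≠ c v) {v : V} {w : G.Walk v v}
    (hw : w.IsCycle) (hX : ∀ x ∈ w.support, x ∈ X)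
    (hcard : (w.support.map c).toFinset.card < 3) :
    IsTwoColoredCycle G c X w.getVert w.length := by
  have hadj : ∀ i < w.length, G.Adj (w.getVert i) (w.getVert (i + 1)) :=
    fun i hi => w.adj_getVert_succ hi
  have hmem : ∀ i, w.getVert i ∈ X := fun i => hX _ (w.getVert_mem_support i)
  have hne : ∀ i < w.length, c (w.getVert i) ≠ c (w.getVert (i + 1)) :=
    fun i hi => hproper _ (hmem _) _ (hmem _) (hadj i hi)
  refine ⟨hw.three_le_length, by simp, hadj, ?_, fun i _ => hmem i, hne, ?_⟩
  · intro i hi j hj e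
    exact hw.getVert_injOn' (by simp; omega) (by simp; omega) e
  · intro i hi
    by_contra hc
    have hsub : ({c (w.getVert i), c (w.getVert (i + 1)), c (w.getVert (i + 2))} : Finset α) ⊆
        (w.support.map c).toFinset := by
      intro x hx
      simp only [Finset.mem_insert, Finset.mem_singleton] at hx
      rw [List.mem_toFinset, List.mem_map]
      rcases hx with rfl | rfl | rfl <;> exact ⟨_, w.getVert_mem_support _, rfl⟩
    have := Finset.card_le_card hsub
    rw [Finset.card_eq_three.2 ⟨_, _, _, hne i (by omega), hc, hne (i + 1) (by omega), rfl⟩] at this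
    omega

theorem notMem (h : IsTwoColoredCycle G c X g n) {S : Finset V}
    (hS : ∀ y ∈ S, y ≠ g 0 → c (g 0) ≠ c y) {i : ℕ} (hi : 0 < i) (hin : 2 * i < n) :
    g (2 * i) ∉ S := by
  intro hmem
  refine hS _ hmem (fun e => ?_) (h.color_even i (by omega)).symm
  have := h.inj _ hin 0 (by omega) e
  omega

end IsTwoColoredCycle

section Finite

variable [Fintype V] [DecidableEq V] [DecidableRel G.Adj]

/-- The vertices extending a path, given as a list starting at its last vertex, without
backtracking. -/
def nextVertices : List V → Finset V
  | a :: b :: _ => (G.neighborFinset a).erase b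
  | _ => ∅

/-- The extensions of the lists in `T` by `n` vertices along non-backtracking walks. -/
def extendPaths (T : Finset (List V)) : ℕ → Finset (List V)
  | 0 => T
  | n + 1 => (extendPaths T n).biUnion fun l => (nextVertices G l).image fun x => x :: l

theorem extendPaths_form {T : Finset (List V)}
    (hT : ∀ l ∈ T, ∃ a b, G.Adj a b ∧ l = [a, b]) (n : ℕ) :
    ∀ l ∈ extendPaths G T n, ∃ a b t, G.Adj a b ∧ l = a :: b :: t ∧ l.length = n + 2 := by
  induction n with
  | zero =>
    intro l hl
    obtain ⟨a, b, hab, rfl⟩ := hT l hl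
    exact ⟨a, b, [], hab, rfl, rfl⟩
  | succ n ih =>
    intro l hl
    simp only [extendPaths, Finset.mem_biUnion, Finset.mem_image] at hl
    obtain ⟨l, hl, x, hx, rfl⟩ := hl
    obtain ⟨a, b, t, hab, rfl, hlen⟩ := ih l hl
    refine ⟨x, a, b :: t, ?_, rfl, by simp at hlen ⊢; omega⟩
    simp only [nextVertices, Finset.mem_erase, SimpleGraph.mem_neighborFinset] at hx
    exact hx.2.symm

theorem card_extendPaths_le {T : Finset (List V)} {Δ : ℕ} (hΔ : G.maxDegree ≤ Δ)
    (hT : ∀ l ∈ T, ∃ a b, G.Adj a b ∧ l = [a, b]) (n : ℕ) :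
    (extendPaths G T n).card ≤ T.card * (Δ - 1) ^ n := by
  induction n with
  | zero => simp [extendPaths]
  | succ n ih =>
    rw [pow_succ, ← mul_assoc]
    refine (Finset.card_biUnion_le_card_mul _ _ (Δ - 1) fun l hl => ?_).trans
      (Nat.mul_le_mul_right _ ih)
    obtain ⟨a, b, t, hab, rfl, -⟩ := extendPaths_form G hT n l hl
    refine Finset.card_image_le.trans ?_
    rw [nextVertices, Finset.card_erase_of_mem (by simpa using hab),
      SimpleGraph.card_neighborFinset_eq_degree]
    exact Nat.sub_le_sub_right ((G.degree_le_maxDegree a).trans hΔ) 1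

theorem pathList_mem_extendPaths {T : Finset (List V)} {g : ℕ → V} (h0 : [g 1, g 0] ∈ T) (m : ℕ)
    (hadj : ∀ i < m, G.Adj (g (i + 1)) (g (i + 2))) (hne : ∀ i < m, g (i + 2) ≠ g i) :
    pathList g (m + 1) ∈ extendPaths G T m := by
  induction m with
  | zero => simpa [extendPaths, pathList] using h0
  | succ m ih =>
    have := ih (fun i hi => hadj i (by omega)) (fun i hi => hne i (by omega))
    rw [extendPaths, Finset.mem_biUnion]
    refine ⟨_, this, Finset.mem_image.2 ⟨g (m + 2), ?_, rfl⟩⟩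
    have hx : g (m + 2) ∈ (G.neighborFinset (g (m + 1))).erase (g m) :=
      Finset.mem_erase.2 ⟨hne m (by omega), by simpa using hadj m (by omega)⟩
    cases m with
    | zero => exact hx
    | succ m => exact hx

/-- The common neighbors of two vertices. -/
def commonNbrs (v u : V) : Finset V := G.neighborFinset v ∩ G.neighborFinset u

/-- The number of common neighbors of `v` and `u`, set to zero if `u = v`. -/
def codegree (v u : V) : ℕ := if u = v then 0 else (commonNbrs G v u).card

theorem sum_codegree_le {Δ : ℕ} (hΔ : G.maxDegree ≤ Δ) (v : V) :
    ∑ u, codegree G v u ≤ Δ * (Δ - 1) := by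
  have h1 : ∀ u, codegree G v u =
      ∑ a ∈ G.neighborFinset v, if u ∈ (G.neighborFinset a).erase v then 1 else 0 := by
    intro u
    rw [codegree, ← Finset.card_filter]
    split_ifs with h
    · simp [h]
    · congr 1
      ext a
      simp [commonNbrs, h, G.adj_comm]
  simp_rw [h1]
  rw [Finset.sum_comm]
  calc _ ≤ ∑ a ∈ G.neighborFinset v, (Δ - 1) := by
        refine Finset.sum_le_sum fun a ha => ?_
        rw [← Finset.card_filter, Finset.filter_mem_eq_inter, Finset.univ_inter,
          Finset.card_erase_of_mem (by simpa [G.adj_comm] using ha),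
          SimpleGraph.card_neighborFinset_eq_degree]
        exact Nat.sub_le_sub_right ((G.degree_le_maxDegree a).trans hΔ) 1
    _ ≤ _ := by
        rw [Finset.sum_const, smul_eq_mul, SimpleGraph.card_neighborFinset_eq_degree]
        exact Nat.mul_le_mul_right _ ((G.degree_le_maxDegree v).trans hΔ)

/-- The paths `v, a, u, b` listed backwards, with `a` and `b` common neighbors of `v` and of a
vertex `u` outside `S`. -/
def fourPaths (v : V) (S : Finset V) : Finset (List V) :=
  (Finset.univ.filter fun u => u ∉ S ∧ u ≠ v).biUnion fun u =>
    (commonNbrs G v u ×ˢ commonNbrs G v u).image fun p => [p.1, u, p.2, v]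

/-- Paths with six vertices having `v` as the second one, listed backwards. -/
def sixPaths (v : V) : Finset (List V) :=
  extendPaths G ((G.neighborFinset v).image fun a => [v, a]) 4

/-- The ways to go around a cycle through `v`, listed backwards, with `n + 3` vertices and the
last but one vertex outside `S`. -/
def cyclePaths (v : V) (S : Finset V) (n : ℕ) : Finset (List V) :=
  (extendPaths G ((G.neighborFinset v).image fun x => [x, v]) n).biUnion fun l =>
    match l with
    | [] => ∅
    | x :: t => if x ∈ S ∨ x = v then ∅ else (commonNbrs G v x).image fun y => y :: x :: t

theorem card_fourPaths_le (v : V) (S : Finset V) :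
    (fourPaths G v S).card ≤ ∑ u ∈ Sᶜ, codegree G v u ^ 2 := by
  refine Finset.card_biUnion_le.trans ?_
  refine (Finset.sum_le_sum fun u hu => ?_).trans (Finset.sum_le_sum_of_subset
    (fun u hu => ?_ : Finset.univ.filter (fun u => u ∉ S ∧ u ≠ v) ⊆ Sᶜ))
  · rw [codegree, if_neg (Finset.mem_filter.1 hu).2.2, sq, ← Finset.card_product]
    exact Finset.card_image_le
  · simpa using (Finset.mem_filter.1 hu).2.1

theorem card_sixPaths_le {Δ : ℕ} (hΔ : G.maxDegree ≤ Δ) (v : V) :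
    (sixPaths G v).card ≤ Δ * (Δ - 1) ^ 4 := by
  refine (card_extendPaths_le G hΔ ?_ 4).trans (Nat.mul_le_mul_right _ ?_)
  · intro l hl
    obtain ⟨a, ha, rfl⟩ := Finset.mem_image.1 hl
    exact ⟨v, a, by simpa using ha, rfl⟩
  · refine Finset.card_image_le.trans ?_
    rw [SimpleGraph.card_neighborFinset_eq_degree]
    exact (G.degree_le_maxDegree v).trans hΔ

theorem start_form (v : V) : ∀ l ∈ (G.neighborFinset v).image fun x => [x, v],
    ∃ a b, G.Adj a b ∧ l = [a, b] := by
  intro l hl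
  obtain ⟨a, ha, rfl⟩ := Finset.mem_image.1 hl
  exact ⟨a, v, by simpa [G.adj_comm] using ha, rfl⟩

theorem card_cyclePaths_le {Δ : ℕ} (hΔ : G.maxDegree ≤ Δ) (v : V) {S : Finset V} {m : ℕ}
    (hm : ∀ u ∉ S, codegree G v u ≤ m) (n : ℕ) :
    (cyclePaths G v S n).card ≤ Δ ^ (n + 1) * m := by
  refine (Finset.card_biUnion_le_card_mul _ _ m fun l _ => ?_).trans (Nat.mul_le_mul_right _ ?_)
  · cases l with
    | nil => simp
    | cons x t =>
      dsimp only
      split_ifs with h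
      · simp
      · rw [not_or] at h
        refine Finset.card_image_le.trans ?_
        have := hm x h.1
        rwa [codegree, if_neg h.2] at this
  · refine (card_extendPaths_le G hΔ (start_form G v) n).trans ?_
    rw [pow_succ']
    refine Nat.mul_le_mul (Finset.card_image_le.trans ?_) (Nat.pow_le_pow_left (Nat.sub_le _ _) _)
    rw [SimpleGraph.card_neighborFinset_eq_degree]
    exact (G.degree_le_maxDegree v).trans hΔ

theorem length_of_mem_fourPaths {v : V} {S : Finset V} {l : List V} (hl : l ∈ fourPaths G v S) :
    l.length = 4 := by
  simp only [fourPaths, Finset.mem_biUnion, Finset.mem_image] at hl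
  obtain ⟨u, -, p, -, rfl⟩ := hl
  rfl

theorem length_of_mem_sixPaths {v : V} {l : List V} (hl : l ∈ sixPaths G v) : l.length = 6 := by
  obtain ⟨_, _, _, -, -, h⟩ := extendPaths_form G (fun l hl => by
    obtain ⟨a, ha, rfl⟩ := Finset.mem_image.1 hl
    exact ⟨v, a, by simpa using ha, rfl⟩) 4 l hl
  exact h

theorem length_of_mem_cyclePaths {v : V} {S : Finset V} {n : ℕ} {l : List V}
    (hl : l ∈ cyclePaths G v S n) : l.length = n + 3 := by
  simp only [cyclePaths, Finset.mem_biUnion] at hl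
  obtain ⟨l', hl', hl⟩ := hl
  obtain ⟨a, b, t, -, rfl, hlen⟩ := extendPaths_form G (start_form G v) n l' hl'
  dsimp only at hl
  split_ifs at hl with h
  · simp at hl
  · obtain ⟨y, -, rfl⟩ := Finset.mem_image.1 hl
    rw [List.length_cons, hlen]

namespace IsTwoColoredCycle

variable {G} {α : Type} {c : V → α} {X : Finset V} {g : ℕ → V} {n : ℕ}

theorem pathList_mem_fourPaths (h : IsTwoColoredCycle G c X g 4) {S : Finset V}
    (hS : g 2 ∉ S) : pathList g 3 ∈ fourPaths G (g 0) S := by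
  have hne : g 2 ≠ g 0 := fun e => absurd (h.inj 2 (by omega) 0 (by omega) e) (by omega)
  have h0 := h.adj 0 (by omega)
  have h1 := h.adj 1 (by omega)
  have h2 := h.adj 2 (by omega)
  have h3 := h.adj 3 (by omega)
  simp only [zero_add, Nat.reduceAdd, h.closed] at h0 h1 h2 h3
  simp only [fourPaths, Finset.mem_biUnion, Finset.mem_image]
  refine ⟨g 2, by simp [hS, hne], (g 3, g 1), ?_, rfl⟩
  simp [commonNbrs, h0, h1.symm, h2, h3.symm]

theorem pathList_mem_sixPaths (h : IsTwoColoredCycle G c X g n) (h6 : 6 ≤ n) :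
    pathList (shiftedCycle g n) 5 ∈ sixPaths G (g 0) := by
  refine pathList_mem_extendPaths G ?_ 4 ?_ ?_
  · refine Finset.mem_image.2 ⟨g (n - 1), ?_, rfl⟩
    have := h.adj (n - 1) (by omega)
    rw [Nat.sub_add_cancel (by omega), h.closed] at this
    simpa using this.symm
  · exact fun i hi => h.adj i (by omega)
  · rintro (_ | i) hi e
    · have := h.inj 1 (by omega) (n - 1) (by omega) e
      omega
    · have := h.inj (i + 2) (by omega) i (by omega) e
      omega

theorem pathList_mem_cyclePaths (h : IsTwoColoredCycle G c X g (n + 3)) {S : Finset V}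
    (hn : 1 ≤ n) (hS : g (n + 1) ∉ S) : pathList g (n + 2) ∈ cyclePaths G (g 0) S n := by
  have hmem : pathList g (n + 1) ∈
      extendPaths G ((G.neighborFinset (g 0)).image fun x => [x, g 0]) n := by
    refine pathList_mem_extendPaths G ?_ n (fun i hi => h.adj (i + 1) (by omega)) ?_
    · exact Finset.mem_image.2 ⟨g 1, by simpa using h.adj 0 (by omega), rfl⟩
    · intro i hi e
      have := h.inj (i + 2) (by omega) i (by omega) e
      omega
  rw [cyclePaths, Finset.mem_biUnion]
  refine ⟨_, hmem, ?_⟩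
  have hne : g (n + 1) ≠ g 0 := fun e => by
    have := h.inj (n + 1) (by omega) 0 (by omega) e
    omega
  have h1 := h.adj (n + 1) (by omega)
  have h2 := h.adj (n + 2) (by omega)
  rw [h.closed] at h2
  simp only [pathList, hS, hne, or_self, if_false]
  refine Finset.mem_image.2 ⟨g (n + 2), ?_, rfl⟩
  simp [commonNbrs, h1, h2.symm]

end IsTwoColoredCycle

/-- Acyclicity of a coloring on the subgraph induced by `X`. -/
def IsAcyclicOn {α : Type} [DecidableEq α] (X : Finset V) (c : V → α) : Prop :=
  (∀ u ∈ X, ∀ v ∈ X, G.Adj u v → c u ≠ c v) ∧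
  ∀ (v : V) (w : G.Walk v v), w.IsCycle → (∀ x ∈ w.support, x ∈ X) →
    3 ≤ (w.support.map c).toFinset.card

variable {G}

theorem exists_isTwoColoredCycle {α : Type} [DecidableEq α] {c : V → α} {X : Finset V} {v : V}
    (hv : v ∈ X) (h : IsAcyclicOn G (X.erase v) c) (h' : ¬ IsAcyclicOn G X c)
    (hN : ∀ y ∈ G.neighborFinset v, c v ≠ c y) :
    ∃ g n, g 0 = v ∧ IsTwoColoredCycle G c X g n := by
  have hproper : ∀ u ∈ X, ∀ v ∈ X, G.Adj u v → c u ≠ c v := by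
    intro x hx y hy hxy
    by_cases hxv : x = v
    · subst hxv
      exact hN y (by simpa using hxy)
    by_cases hyv : y = v
    · subst hyv
      exact (hN x (by simpa using hxy.symm)).symm
    · exact h.1 x (by simp [hx, hxv]) y (by simp [hy, hyv]) hxy
  simp only [IsAcyclicOn, not_and, not_forall, not_le] at h'
  obtain ⟨u, w, hw, hX, hcard⟩ := h' hproper
  have hvw : v ∈ w.support := by
    by_contra hvw
    exact absurd (h.2 u w hw fun x hx => Finset.mem_erase.2 ⟨fun e => hvw (e ▸ hx), hX x hx⟩)
      (by omega)
  have hsub : ∀ x ∈ (w.rotate v hvw).support, x ∈ w.support := by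
    intro x hx
    simpa using hx
  refine ⟨(w.rotate v hvw).getVert, (w.rotate v hvw).length, by simp,
    IsTwoColoredCycle.of_walk hproper (hw.rotate hvw) (fun x hx => hX x (hsub x hx)) ?_⟩
  refine lt_of_le_of_lt (Finset.card_le_card ?_) hcard
  intro x hx
  simp only [List.mem_toFinset, List.mem_map] at hx ⊢
  obtain ⟨y, hy, rfl⟩ := hx
  exact ⟨y, hsub y hy, rfl⟩

theorem exists_isAcyclicColoring {α : Type} [Fintype α] [DecidableEq α] [Nonempty α] {Δ k : ℕ}
    (hΔ : G.maxDegree ≤ Δ) (S : V → Finset V) (hS : ∀ v, (S v).card ≤ k)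
    {β : ℝ} (hβ : 0 < β) (J : ℕ) (T : V → ℕ → Finset (List V))
    (hT : ∀ v i, ∀ l ∈ T v i, l.length = 2 * i + 4)
    (hbad : ∀ (X : Finset V) (c : V → α) g n, IsTwoColoredCycle G c X g n →
      (∀ y ∈ S (g 0), y ≠ g 0 → c (g 0) ≠ c y) →
      ∃ i < J, ∃ l ∈ T (g 0) i, ∃ l' ∈ T (g 0) i, l ≠ l' ∧
        AlternatesThrough X (g 0) c l ∧ AlternatesThrough X (g 0) c l')
    (hcard : ∀ v, β + Δ + k + (∑ i ∈ Finset.range J, (T v i).card * β⁻¹ ^ (2 * i + 1)) / 2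
      ≤ Fintype.card α) :
    ∃ c : V → α, IsAcyclicColoring G c := by
  suffices h : ∃ c : V → α, IsAcyclicOn G Finset.univ c by
    obtain ⟨c, hc⟩ := h
    exact ⟨c, fun u v => hc.1 u (Finset.mem_univ u) v (Finset.mem_univ v),
      fun v w hw => hc.2 v w hw fun x _ => Finset.mem_univ x⟩
  refine exists_coloring_of_weight_le
    (fun X Y c hYX h => ⟨fun u hu v hv => h.1 u (hYX hu) v (hYX hv),
      fun v w hw hY => h.2 v w hw fun x hx => hYX (hY x hx)⟩)
    (fun X c c' hcc h => ⟨fun u hu v hv => by rw [← hcc u hu, ← hcc v hv]; exact h.1 u hu v hv,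
      fun v w hw hX => by
        rw [← List.map_congr_left fun x hx => hcc x (hX x hx)]
        exact h.2 v w hw hX⟩)
    (fun c => ⟨by simp, fun v w hw h => absurd (h v w.start_mem_support) (by simp)⟩)
    hβ J (fun v => G.neighborFinset v ∪ S v) T hT ?_ ?_
  · intro X v c hv h h'
    by_cases hF : ∃ y ∈ G.neighborFinset v ∪ S v, y ≠ v ∧ c v = c y
    · exact Or.inl hF
    · push Not at hF
      obtain ⟨g, n, rfl, hg⟩ := exists_isTwoColoredCycle hv h h' fun y hy =>
        hF y (Finset.mem_union_left _ hy) (by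
          rintro rfl
          simp at hy)
      exact Or.inr (hbad X c g n hg fun y hy => hF y (Finset.mem_union_right _ hy))
  · intro v
    refine le_trans ?_ (hcard v)
    have h1 : ((G.neighborFinset v ∪ S v).card : ℝ) ≤ Δ + k := by
      have h2 := Finset.card_union_le (G.neighborFinset v) (S v)
      rw [SimpleGraph.card_neighborFinset_eq_degree] at h2
      exact_mod_cast h2.trans (Nat.add_le_add ((G.degree_le_maxDegree v).trans hΔ) (hS v))
    linarith

theorem acyclicChromaticNumber_lt_add_one {Δ k : ℕ}
    (hΔ : G.maxDegree ≤ Δ) (S : V → Finset V) (hS : ∀ v, (S v).card ≤ k)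
    {β : ℝ} (hβ : 0 < β) (J : ℕ) (T : V → ℕ → Finset (List V))
    (hT : ∀ v i, ∀ l ∈ T v i, l.length = 2 * i + 4)
    (idx : ℕ → ℕ) (L : ℕ → (ℕ → V) → List V)
    (hL : ∀ n g g', L n g = L n g' → g (n - 1) = g' (n - 1))
    (hbad : ∀ (α : Type) (X : Finset V) (c : V → α) g n, IsTwoColoredCycle G c X g n →
      (∀ y ∈ S (g 0), y ≠ g 0 → c (g 0) ≠ c y) →
      idx n < J ∧ L n g ∈ T (g 0) (idx n) ∧ AlternatesThrough X (g 0) c (L n g))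
    {Q : ℝ} (hQ : 0 < Q)
    (hcard : ∀ v, β + Δ + k + (∑ i ∈ Finset.range J, (T v i).card * β⁻¹ ^ (2 * i + 1)) / 2 ≤ Q) :
    (acyclicChromaticNumber G : ℝ) < Q + 1 := by
  have : NeZero ⌈Q⌉₊ := ⟨(Nat.ceil_pos.2 hQ).ne'⟩
  have h : acyclicChromaticNumber G ≤ ⌈Q⌉₊ := Nat.sInf_le <|
    exists_isAcyclicColoring (α := Fin ⌈Q⌉₊) hΔ S hS hβ J T hT
      (fun X c g n hg hgS => by
        obtain ⟨hi, hl, halt⟩ := hbad _ X c g n hg hgS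
        have h0 : g (n - 0) = g 0 := hg.closed
        obtain ⟨-, hl', halt'⟩ := hbad _ X c _ n hg.reverse (by rwa [h0])
        rw [h0] at hl' halt'
        refine ⟨idx n, hi, _, hl, _, hl', fun e => ?_, halt, halt'⟩
        have h3 := hg.three_le
        have := hg.inj _ (by omega) _ (by omega) (hL n g (fun i => g (n - i)) e)
        omega)
      fun v => (hcard v).trans (by simpa using Nat.le_ceil Q)
  exact lt_of_le_of_lt (Nat.cast_le.2 h) (Nat.ceil_lt_add_one hQ.le)

end Finite

end Graph

section Numeric

theorem exists_largest_values {V : Type} [Fintype V] [DecidableEq V] (d : V → ℕ) (k : ℕ) :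
    ∃ S : Finset V, S.card ≤ k ∧ ∃ m, (∀ u ∉ S, d u ≤ m) ∧
      k * m + ∑ u ∈ Sᶜ, d u ≤ ∑ u, d u := by
  have key : ∃ S : Finset V, S.card ≤ k ∧
      (S = Finset.univ ∨ S.card = k ∧ ∀ x ∈ S, ∀ y ∉ S, d y ≤ d x) := by
    induction k with
    | zero => exact ⟨∅, by simp⟩
    | succ k ih =>
      obtain ⟨S, hS, rfl | ⟨hk, h⟩⟩ := ih
      · exact ⟨Finset.univ, by omega, Or.inl rfl⟩
      rcases Sᶜ.eq_empty_or_nonempty with hne | hne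
      · exact ⟨S, by omega, Or.inl (by simpa using hne)⟩
      obtain ⟨a, ha, hmax⟩ := Finset.exists_max_image Sᶜ d hne
      rw [Finset.mem_compl] at ha
      have hc : (insert a S).card = k + 1 := by rw [Finset.card_insert_of_notMem ha, hk]
      refine ⟨insert a S, hc.le, Or.inr ⟨hc, fun x hx y hy => ?_⟩⟩
      rw [Finset.mem_insert, not_or] at hy
      rcases Finset.mem_insert.1 hx with rfl | hx
      · exact hmax y (by simpa using hy.2)
      · exact h x hx y hy.2
  obtain ⟨S, hS, rfl | ⟨hk, h⟩⟩ := key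
  · exact ⟨Finset.univ, hS, 0, by simp⟩
  · refine ⟨S, hS, Sᶜ.sup d, fun u hu => Finset.le_sup (by simpa using hu), ?_⟩
    rw [← Finset.sum_add_sum_compl S d, ← hk, ← smul_eq_mul]
    refine Nat.add_le_add_right (Finset.card_nsmul_le_sum _ _ _ fun x hx => ?_) _
    exact Finset.sup_le fun y hy => h x hx y (by simpa using hy)

variable {V : Type} [Fintype V] [DecidableEq V] (G : SimpleGraph V) [DecidableRel G.Adj]

theorem exists_special_vertices {Δ : ℕ} (hΔ : G.maxDegree ≤ Δ) (k : ℕ) :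
    ∃ S : V → Finset V, ∀ v, (S v).card ≤ k ∧
      4 * k * (fourPaths G v (S v)).card ≤ (Δ * (Δ - 1)) ^ 2 ∧
      ∀ n, k * (cyclePaths G v (S v) n).card ≤ Δ ^ (n + 1) * (Δ * (Δ - 1)) := by
  choose S hS m hm hsum using fun v => exists_largest_values (codegree G v) k
  refine ⟨S, fun v => ⟨hS v, ?_, fun n => ?_⟩⟩
  · have h1 : (fourPaths G v (S v)).card ≤ m v * ∑ u ∈ (S v)ᶜ, codegree G v u := by
      refine (card_fourPaths_le G v (S v)).trans ?_
      rw [Finset.mul_sum]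
      refine Finset.sum_le_sum fun u hu => ?_
      rw [sq]
      exact Nat.mul_le_mul_right _ (hm v u (by simpa using hu))
    have h2 := (hsum v).trans (sum_codegree_le G hΔ v)
    calc _ ≤ 4 * k * (m v * ∑ u ∈ (S v)ᶜ, codegree G v u) := Nat.mul_le_mul_left _ h1
      _ = 4 * (k * m v) * ∑ u ∈ (S v)ᶜ, codegree G v u := by ring
      _ ≤ (k * m v + ∑ u ∈ (S v)ᶜ, codegree G v u) ^ 2 := four_mul_le_sq_add _ _
      _ ≤ _ := Nat.pow_le_pow_left h2 2
  · have h2 : k * m v ≤ Δ * (Δ - 1) :=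
      (Nat.le_add_right _ _).trans ((hsum v).trans (sum_codegree_le G hΔ v))
    calc _ ≤ k * (Δ ^ (n + 1) * m v) :=
          Nat.mul_le_mul_left _ (card_cyclePaths_le G hΔ v (hm v) n)
      _ = Δ ^ (n + 1) * (k * m v) := by ring
      _ ≤ _ := Nat.mul_le_mul_left _ h2

variable {G} {Δ k : ℕ} {t : ℝ}

theorem weight_fourPaths_le (ht : 0 < t) (htΔ : t ^ 3 = Δ) (hk : t ^ 4 / 2 ≤ k)
    {x : ℕ} (hx : 4 * k * x ≤ (Δ * (Δ - 1)) ^ 2) (h24 : 24 ≤ Δ) :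
    x * (t ^ 4 / 2)⁻¹ / 2 ≤ t ^ 4 / 2 - 2 := by
  have hx' : 4 * (k : ℝ) * x ≤ (t ^ 3 * (t ^ 3 - 1)) ^ 2 := by
    rw [htΔ, ← Nat.cast_pred (by omega : 0 < Δ)]
    exact_mod_cast hx
  have h3 : (24 : ℝ) ≤ t ^ 3 := by rw [htΔ]; exact_mod_cast h24
  have h28 : (2.5 : ℝ) ≤ t := by
    by_contra! h
    have := pow_lt_pow_left₀ h ht.le (n := 3) (by norm_num)
    norm_num at this
    linarith
  have h1 : 2 * t ^ 4 * x ≤ (t ^ 3 * (t ^ 3 - 1)) ^ 2 := by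
    refine le_trans ?_ hx'
    have : (0 : ℝ) ≤ x := Nat.cast_nonneg x
    nlinarith
  have h2 : x * (t ^ 4 / 2)⁻¹ / 2 = x / t ^ 4 := by field_simp
  have h4 : (x : ℝ) ≤ t ^ 2 * (t ^ 3 - 1) ^ 2 / 2 := by
    have h5 : 2 * t ^ 4 * x ≤ 2 * t ^ 4 * (t ^ 2 * (t ^ 3 - 1) ^ 2 / 2) := by
      refine h1.trans (le_of_eq ?_)
      ring
    exact le_of_mul_le_mul_left h5 (by positivity)
  rw [h2, div_le_iff₀ (by positivity)]
  refine h4.trans ?_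
  have h6 : 0 ≤ t ^ 2 * (2 * t ^ 3 - 4 * t ^ 2 - 1) := by
    have : 0 ≤ t ^ 2 * (t - 2.5) := mul_nonneg (by positivity) (by linarith)
    have : 6.25 ≤ t ^ 2 := by nlinarith
    exact mul_nonneg (by positivity) (by nlinarith)
  nlinarith

theorem weight_sixPaths_le (ht : 0 < t) (htΔ : t ^ 3 = Δ) {x : ℕ} (hx : x ≤ Δ * (Δ - 1) ^ 4)
    (h24 : 24 ≤ Δ) :
    x * (t ^ 4 / 2)⁻¹ ^ 3 / 2 ≤ 4 * (Δ : ℝ) - 15 := by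
  have hx' : (x : ℝ) ≤ Δ * (Δ - 1) ^ 4 := by
    rw [← Nat.cast_pred (by omega : 0 < Δ)]
    exact_mod_cast hx
  have h24' : (24 : ℝ) ≤ Δ := by exact_mod_cast h24
  have h1 : x * (t ^ 4 / 2)⁻¹ ^ 3 / 2 = 4 * x / (Δ : ℝ) ^ 4 := by
    rw [← htΔ]
    field_simp
    norm_num
  rw [h1, div_le_iff₀ (by positivity)]
  have h2 : 0 ≤ (Δ : ℝ) ^ 3 * (Δ - 24) := mul_nonneg (by positivity) (by linarith)
  nlinarith [mul_nonneg (sub_nonneg.2 h24') (by linarith : (0 : ℝ) ≤ Δ)]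

theorem weight_cyclePaths_le (ht : 0 < t) (htΔ : t ^ 3 = Δ) (hk : t ^ 4 / 2 ≤ k)
    {x i : ℕ} (hx : k * x ≤ Δ ^ (2 * i + 4) * (Δ * (Δ - 1))) :
    x * (t ^ 4 / 2)⁻¹ ^ (2 * i + 3) ≤ 16 * t ^ 2 * (4 / t ^ 2) ^ i := by
  have hx' : (k : ℝ) * x ≤ (t ^ 3) ^ (2 * i + 4) * (t ^ 3 * t ^ 3) := by
    rw [htΔ]
    exact_mod_cast hx.trans
      (Nat.mul_le_mul_left _ (Nat.mul_le_mul_left _ (Nat.sub_le Δ 1)))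
  have h2 : t ^ 4 / 2 * x ≤ (t ^ 3) ^ (2 * i + 4) * (t ^ 3 * t ^ 3) :=
    (mul_le_mul_of_nonneg_right hk (Nat.cast_nonneg x)).trans hx'
  have h3 : (x : ℝ) ≤ (t ^ 3) ^ (2 * i + 4) * (t ^ 3 * t ^ 3) / (t ^ 4 / 2) := by
    rw [le_div_iff₀ (by positivity)]
    linarith
  refine (mul_le_mul_of_nonneg_right h3 (by positivity)).trans (le_of_eq ?_)
  have h4 : (4 : ℝ) ^ i = 2 ^ (2 * i) := by rw [pow_mul]; norm_num
  rw [div_pow, inv_pow, div_pow, h4]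
  field_simp
  ring

theorem acyclicChromaticNumber_lt_of_sixPaths (hΔ : G.maxDegree ≤ Δ) (h24 : 24 ≤ Δ)
    (ht : 0 < t) (htΔ : t ^ 3 = Δ) :
    (acyclicChromaticNumber G : ℝ) < 3 / 2 * t ^ 4 + 5 * Δ - 14 := by
  have h24' : (24 : ℝ) ≤ Δ := by exact_mod_cast h24
  have ht4 : 0 < t ^ 4 := by positivity
  have hk := Nat.le_ceil (t ^ 4 / 2)
  have hk' := Nat.ceil_lt_add_one (by positivity : 0 ≤ t ^ 4 / 2)
  obtain ⟨S, hS⟩ := exists_special_vertices G hΔ ⌈t ^ 4 / 2⌉₊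
  have h := acyclicChromaticNumber_lt_add_one hΔ S (fun v => (hS v).1)
    (by positivity : 0 < t ^ 4 / 2) 2
    (fun v i => match i with
      | 0 => fourPaths G v (S v)
      | 1 => sixPaths G v
      | _ => ∅)
    ?_ (fun n => if n = 4 then 0 else 1)
    (fun n g => pathList (if n = 4 then g else shiftedCycle g n) (if n = 4 then 3 else 5)) ?_ ?_
    (by linarith : 0 < 3 / 2 * t ^ 4 + 5 * Δ - 16) ?_
  · linarith
  · rintro v (_ | _ | i) l hl
    · exact length_of_mem_fourPaths G hl
    · exact length_of_mem_sixPaths G hl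
    · simp at hl
  · intro n g g' e
    by_cases hn : n = 4
    · subst hn
      exact eq_of_pathList_eq e 3 le_rfl
    · simp only [hn, if_false] at e
      exact eq_of_pathList_eq e 0 (by omega)
  · intro α X c g n hg hgS
    obtain ⟨i, hi⟩ := hg.exists_length_eq
    by_cases hn : n = 4
    · subst hn
      exact ⟨by simp, hg.pathList_mem_fourPaths (hg.notMem hgS (i := 1) (by omega) (by omega)),
        hg.alternatesThrough_pathList le_rfl⟩
    · simp only [hn, if_false]
      exact ⟨by omega, hg.pathList_mem_sixPaths (by omega),
        hg.alternatesThrough_shiftedCycle (by omega)⟩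
  · intro v
    have h4 := weight_fourPaths_le ht htΔ hk (hS v).2.1 h24
    have h6 := weight_sixPaths_le ht htΔ (card_sixPaths_le G hΔ v) h24
    rw [Finset.sum_range_succ, Finset.sum_range_one, add_div]
    norm_num only [mul_zero, mul_one, zero_add, pow_one] at h4 h6 ⊢
    linarith

theorem acyclicChromaticNumber_lt_of_cyclePaths (hΔ : G.maxDegree ≤ Δ) (h24 : 24 ≤ Δ)
    (ht : 0 < t) (htΔ : t ^ 3 = Δ) (ht2 : 4 < t ^ 2) :
    (acyclicChromaticNumber G : ℝ) <
      3 / 2 * t ^ 4 + Δ + 8 * t ^ 4 / (t ^ 2 - 4) + 1 := by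
  have h24' : (24 : ℝ) ≤ Δ := by exact_mod_cast h24
  have ht4 : 0 < t ^ 4 := by positivity
  have hpos : 0 < 8 * t ^ 4 / (t ^ 2 - 4) := div_pos (by positivity) (by linarith)
  have hk := Nat.le_ceil (t ^ 4 / 2)
  have hk' := Nat.ceil_lt_add_one (by positivity : 0 ≤ t ^ 4 / 2)
  obtain ⟨S, hS⟩ := exists_special_vertices G hΔ ⌈t ^ 4 / 2⌉₊
  refine acyclicChromaticNumber_lt_add_one hΔ S (fun v => (hS v).1)
    (by positivity : 0 < t ^ 4 / 2) (Fintype.card V + 1)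
    (fun v i => match i with
      | 0 => fourPaths G v (S v)
      | i + 1 => cyclePaths G v (S v) (2 * i + 3))
    ?_ (fun n => (n - 4) / 2) (fun n g => pathList g (n - 1)) ?_ ?_
    (by linarith : 0 < 3 / 2 * t ^ 4 + Δ + 8 * t ^ 4 / (t ^ 2 - 4)) ?_
  · rintro v (_ | i) l hl
    · exact length_of_mem_fourPaths G hl
    · exact length_of_mem_cyclePaths G hl
  · exact fun n g g' e => eq_of_pathList_eq e (n - 1) le_rfl
  · intro α X c g n hg hgS
    obtain ⟨i, rfl⟩ := hg.exists_length_eq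
    have hlen := hg.length_le
    refine ⟨by omega, ?_, hg.alternatesThrough_pathList (by omega)⟩
    rw [show (2 * i + 4 - 4) / 2 = i by omega]
    cases i with
    | zero => exact hg.pathList_mem_fourPaths (hg.notMem hgS (i := 1) (by omega) (by omega))
    | succ i =>
      exact IsTwoColoredCycle.pathList_mem_cyclePaths (n := 2 * i + 3) hg (by omega)
        (hg.notMem hgS (i := i + 2) (by omega) (by omega))
  · intro v
    have h4 := weight_fourPaths_le ht htΔ hk (hS v).2.1 h24
    have hq : 4 / t ^ 2 < 1 := by rw [div_lt_one (by positivity)]; exact ht2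
    have hgeom : ∑ i ∈ Finset.range (Fintype.card V), 16 * t ^ 2 * (4 / t ^ 2) ^ i ≤
        2 * (8 * t ^ 4 / (t ^ 2 - 4)) := by
      rw [← Finset.mul_sum]
      have h1 := (summable_geometric_of_lt_one (by positivity) hq).sum_le_tsum
        (Finset.range (Fintype.card V)) (fun i _ => by positivity)
      rw [tsum_geometric_of_lt_one (by positivity) hq] at h1
      refine (mul_le_mul_of_nonneg_left h1 (by positivity)).trans (le_of_eq ?_)
      have : t ^ 2 - 4 ≠ 0 := by linarith
      field_simp
      ring
    have hc := (Finset.sum_le_sum fun i (_ : i ∈ Finset.range (Fintype.card V)) =>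
      weight_cyclePaths_le ht htΔ hk ((hS v).2.2 (2 * i + 3))).trans hgeom
    rw [Finset.sum_range_succ', add_div]
    norm_num only [mul_zero, zero_add, pow_one, mul_add, add_assoc] at h4 hc ⊢
    linarith

end Numeric

theorem stmt0 {V : Type} [Fintype V] (G : SimpleGraph V) [DecidableRel G.Adj]
    (Δ : ℕ) (hΔ : G.maxDegree = Δ) (h24 : 24 ≤ Δ) :
    (acyclicChromaticNumber G : ℝ) <
      min ((3 / 2) * (Δ : ℝ) ^ ((4 : ℝ) / 3) + 5 * (Δ : ℝ) - 14)
        ((3 / 2) * (Δ : ℝ) ^ ((4 : ℝ) / 3) + (Δ : ℝ)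
          + 8 * (Δ : ℝ) ^ ((4 : ℝ) / 3) / ((Δ : ℝ) ^ ((2 : ℝ) / 3) - 4) + 1) := by
  classical
  have hΔ0 : (0 : ℝ) ≤ Δ := Nat.cast_nonneg Δ
  have h24' : (24 : ℝ) ≤ Δ := by exact_mod_cast h24
  have hpow : ∀ n : ℕ, (Δ : ℝ) ^ ((n : ℝ) / 3) = ((Δ : ℝ) ^ ((1 : ℝ) / 3)) ^ n := by
    intro n
    rw [← Real.rpow_natCast, ← Real.rpow_mul hΔ0]
    congr 1
    ring
  have h4 := hpow 4
  have h2 := hpow 2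
  have h3 := hpow 3
  norm_num only [Nat.cast_ofNat, Real.rpow_one] at h2 h3 h4
  have ht : 0 < (Δ : ℝ) ^ ((1 : ℝ) / 3) := Real.rpow_pos_of_pos (by linarith) _
  norm_num only at ht
  rw [h4, h2]
  have ht2 : 4 < ((Δ : ℝ) ^ (1 / 3 : ℝ)) ^ 2 := by
    by_contra! h
    have h1 : (Δ : ℝ) ^ (1 / 3 : ℝ) ≤ 2 := by nlinarith
    have := pow_le_pow_left₀ ht.le h1 3
    linarith
  exact lt_min (acyclicChromaticNumber_lt_of_sixPaths hΔ.le h24 ht h3.symm)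
    (acyclicChromaticNumber_lt_of_cyclePaths hΔ.le h24 ht h3.symm ht2)
end

section
/- Every graph G with maximum degree Δ ≥ 9 satisfies χ_a(G) < (3/2)·Δ^(4/3) + Δ + 8·Δ^(4/3)/(Δ^(2/3) − 4) + 1, where χ_a(G) is the acyclic chromatic number of G. -/
theorem card_mul_pow_le_of_determined {V α : Type*} [Fintype α] [DecidableEq V]
    (A B : Finset (V → α)) (T : Finset V)
    (hAB : ∀ c ∈ A, ∀ c', (∀ y ∉ T, c' y = c y) → c' ∈ B)
    (hdet : ∀ c ∈ A, ∀ c' ∈ A, (∀ y ∉ T, c y = c' y) → c = c') :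
    A.card * Fintype.card α ^ T.card ≤ B.card := by
  classical
  have hcard : (A ×ˢ (Finset.univ : Finset (T → α))).card = A.card * Fintype.card α ^ T.card := by
    simp
  rw [← hcard]
  refine Finset.card_le_card_of_injOn
    (fun q y => if h : y ∈ T then q.2 ⟨y, h⟩ else q.1 y) ?_ ?_
  · rintro ⟨c, f⟩ hq
    have hc : c ∈ A := by simpa using hq
    exact hAB c hc _ fun y hy => by simp [hy]
  · rintro ⟨c, f⟩ hq ⟨c', f'⟩ hq' h
    have hc : c ∈ A := by simpa using hq
    have hc' : c' ∈ A := by simpa using hq'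
    have h1 : c = c' := hdet c hc c' hc' fun y hy => by simpa [hy] using congrFun h y
    have h2 : f = f' := funext fun y => by simpa [y.2] using congrFun h y.1
    rw [h1, h2]

namespace SimpleGraph

variable {V : Type} [Fintype V] [DecidableEq V] (G : SimpleGraph V) [DecidableRel G.Adj]

/-- The common neighbors of two vertices, as a finset. -/
def commonNeighborFinset (u w : V) : Finset V := G.neighborFinset u ∩ G.neighborFinset w

theorem mem_commonNeighborFinset {u w y : V} :
    y ∈ G.commonNeighborFinset u w ↔ G.Adj u y ∧ G.Adj w y := by
  simp [commonNeighborFinset]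

/-- Two vertices conflict at threshold `x` if they are adjacent, or distinct with more than `x`
common neighbors. -/
def Conflict (x : ℝ) (u w : V) : Prop :=
  G.Adj u w ∨ u ≠ w ∧ x < (G.commonNeighborFinset u w).card

theorem Conflict.symm {G : SimpleGraph V} [DecidableRel G.Adj] {x : ℝ} {u w : V}
    (h : G.Conflict x u w) : G.Conflict x w u := by
  rcases h with h | ⟨h, h'⟩
  · exact Or.inl h.symm
  · exact Or.inr ⟨h.symm, by rwa [commonNeighborFinset, Finset.inter_comm]⟩

open Classical in
/-- The maps `V → Fin k` that color conflicting vertices of `S` differently and use at least three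
colors on every cycle inside `S`. -/
noncomputable def goodColorings (x : ℝ) (k : ℕ) (S : Finset V) : Finset (V → Fin k) :=
  {c | (∀ u ∈ S, ∀ w ∈ S, G.Conflict x u w → c u ≠ c w) ∧
    ∀ (v : V) (w : G.Walk v v), w.IsCycle → (∀ y ∈ w.support, y ∈ S) →
      3 ≤ (w.support.map c).toFinset.card}

theorem mem_goodColorings {x : ℝ} {k : ℕ} {S : Finset V} {c : V → Fin k} :
    c ∈ G.goodColorings x k S ↔ (∀ u ∈ S, ∀ w ∈ S, G.Conflict x u w → c u ≠ c w) ∧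
    ∀ (v : V) (w : G.Walk v v), w.IsCycle → (∀ y ∈ w.support, y ∈ S) →
      3 ≤ (w.support.map c).toFinset.card := by
  simp [goodColorings]

theorem mem_goodColorings_of_eqOn {x : ℝ} {k : ℕ} {S S' : Finset V} {c c' : V → Fin k}
    (hS : S' ⊆ S) (hc : c ∈ G.goodColorings x k S) (h : ∀ y ∈ S', c' y = c y) :
    c' ∈ G.goodColorings x k S' := by
  rw [mem_goodColorings] at hc ⊢
  refine ⟨fun u hu w hw huw => ?_, fun v w hw hwS => ?_⟩
  · rw [h u hu, h w hw]
    exact hc.1 u (hS hu) w (hS hw) huw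
  · rw [List.map_congr_left fun y hy => h y (hwS y hy)]
    exact hc.2 v w hw fun y hy => hS (hwS y hy)

theorem goodColorings_empty (x : ℝ) (k : ℕ) : G.goodColorings x k ∅ = Finset.univ := by
  ext c
  simp only [mem_goodColorings, Finset.notMem_empty, false_imp_iff, implies_true, true_and,
    Finset.mem_univ, iff_true]
  exact fun v w _ hw => absurd (hw v w.start_mem_support) id

theorem isAcyclicColoring_of_mem_goodColorings_univ {x : ℝ} {k : ℕ} {c : V → Fin k}
    (hc : c ∈ G.goodColorings x k Finset.univ) : IsAcyclicColoring G c := by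
  rw [mem_goodColorings] at hc
  exact ⟨fun u v h => hc.1 u (Finset.mem_univ _) v (Finset.mem_univ _) (Or.inl h),
    fun v w hw => hc.2 v w hw fun y _ => Finset.mem_univ y⟩

theorem sum_card_finsetWalkLength_le {Δ : ℕ} (hΔ : ∀ v, G.degree v ≤ Δ) (n : ℕ) (v : V) :
    ∑ u, (G.finsetWalkLength n v u).card ≤ Δ ^ n := by
  induction n generalizing v with
  | zero =>
    rw [Finset.sum_eq_single_of_mem v (Finset.mem_univ v)]
    · simp [finsetWalkLength]
    · intro u _ hu
      simp [finsetWalkLength, hu.symm]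
  | succ n ih =>
    calc ∑ u, (G.finsetWalkLength (n + 1) v u).card
        ≤ ∑ u, ∑ w : G.neighborSet v, (G.finsetWalkLength n w u).card := by
          refine Finset.sum_le_sum fun u _ => ?_
          rw [finsetWalkLength]
          exact Finset.card_biUnion_le.trans (by simp)
      _ = ∑ w : G.neighborSet v, ∑ u, (G.finsetWalkLength n w u).card := Finset.sum_comm
      _ ≤ ∑ w : G.neighborSet v, Δ ^ n := Finset.sum_le_sum fun w _ => ih w
      _ ≤ Δ ^ (n + 1) := by
          rw [Finset.sum_const, smul_eq_mul, Finset.card_univ, card_neighborSet_eq_degree, pow_succ']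
          exact Nat.mul_le_mul_right _ (hΔ v)

theorem sum_card_commonNeighborFinset_le {Δ : ℕ} (hΔ : ∀ v, G.degree v ≤ Δ) (v : V) :
    ∑ u, (G.commonNeighborFinset v u).card ≤ Δ ^ 2 := by
  calc ∑ u, (G.commonNeighborFinset v u).card
      = ∑ y ∈ G.neighborFinset v, G.degree y := by
        simp only [← card_neighborFinset_eq_degree, Finset.card_eq_sum_ones, Finset.sum_sigma']
        refine Finset.sum_bij' (fun q _ => ⟨q.2, q.1⟩) (fun q _ => ⟨q.2, q.1⟩) ?_ ?_ ?_ ?_ ?_ <;>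
          simp +contextual [mem_commonNeighborFinset, adj_comm]
    _ ≤ ∑ y ∈ G.neighborFinset v, Δ := Finset.sum_le_sum fun y _ => hΔ y
    _ ≤ Δ ^ 2 := by
        rw [Finset.sum_const, smul_eq_mul, card_neighborFinset_eq_degree, pow_two]
        exact Nat.mul_le_mul_right _ (hΔ v)

theorem pow_mul_card_goodColorings_sdiff_le {x β : ℝ} {k : ℕ} (hβ : 0 ≤ β) {S : Finset V}
    (ih : ∀ S' ⊂ S, ∀ v ∉ S', β * (G.goodColorings x k S').card ≤
      k * (G.goodColorings x k (insert v S')).card)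
    {R : Finset V} (hR : R ⊆ S) :
    β ^ R.card * (G.goodColorings x k (S \ R)).card ≤
      k ^ R.card * ((G.goodColorings x k S).card : ℝ) := by
  induction R using Finset.induction_on with
  | empty => simp
  | insert r R hr ihR =>
    have hrS : r ∈ S := hR (Finset.mem_insert_self r R)
    have h1 := ihR fun y hy => hR (Finset.mem_insert_of_mem hy)
    have h2 := ih (S \ insert r R)
      (Finset.sdiff_ssubset hR (Finset.insert_nonempty r R)) r (by simp)
    have h3 : insert r (S \ insert r R) = S \ R := by
      ext y
      by_cases hy : y = r <;> simp [hy, hrS, hr]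
    rw [h3] at h2
    rw [Finset.card_insert_of_notMem hr, pow_succ, pow_succ]
    calc β ^ R.card * β * ((G.goodColorings x k (S \ insert r R)).card : ℝ)
        = β ^ R.card * (β * (G.goodColorings x k (S \ insert r R)).card) := by ring
      _ ≤ β ^ R.card * (k * (G.goodColorings x k (S \ R)).card) := by gcongr
      _ = k * (β ^ R.card * (G.goodColorings x k (S \ R)).card) := by ring
      _ ≤ k * (k ^ R.card * (G.goodColorings x k S).card) := by gcongr
      _ = _ := by ring

theorem card_mul_le_of_determined {x β : ℝ} {k : ℕ} (hβ : 0 ≤ β) (hβk : β ≤ k) (hk : 0 < k)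
    {S : Finset V}
    (ih : ∀ S' ⊂ S, ∀ v ∉ S', β * (G.goodColorings x k S').card ≤
      k * (G.goodColorings x k (insert v S')).card)
    {v : V} (hvS : v ∉ S) {R : Finset V} (hvR : v ∉ R) {A : Finset (V → Fin k)}
    (hA : A ⊆ G.goodColorings x k S)
    (hdet : ∀ c ∈ A, ∀ c' ∈ A, (∀ y ∉ insert v R, c y = c' y) → c = c') :
    (A.card : ℝ) * (k * β ^ R.card) ≤ (G.goodColorings x k S).card := by
  have hk' : (0 : ℝ) < k := by exact_mod_cast hk
  have h1 := card_mul_pow_le_of_determined A (G.goodColorings x k (S \ R))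
    (insert v R) (fun c hc c' h => G.mem_goodColorings_of_eqOn
      Finset.sdiff_subset (hA hc) fun y hy => h y (by
        simp only [Finset.mem_sdiff] at hy
        have : y ≠ v := fun h => hvS (h ▸ hy.1)
        simp [this, hy.2])) hdet
  rw [Finset.card_insert_of_notMem hvR, Fintype.card_fin] at h1
  replace h1 : (A.card : ℝ) * k ^ (R.card + 1) ≤ (G.goodColorings x k (S \ R)).card := by
    exact_mod_cast h1
  have h2 := G.pow_mul_card_goodColorings_sdiff_le (k := k) hβ ih
    (Finset.inter_subset_left : S ∩ R ⊆ S)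
  rw [Finset.sdiff_inter_self_left] at h2
  obtain ⟨j, hj⟩ := Nat.exists_eq_add_of_le
    (Finset.card_le_card (Finset.inter_subset_right : S ∩ R ⊆ R))
  set i := (S ∩ R).card
  rw [hj] at h1 ⊢
  refine le_of_mul_le_mul_left ?_ (pow_pos hk' (i + j))
  calc (k : ℝ) ^ (i + j) * (A.card * (k * β ^ (i + j)))
      = β ^ i * β ^ j * (A.card * k ^ (i + j + 1)) := by ring
    _ ≤ β ^ i * k ^ j * (G.goodColorings x k (S \ R)).card := by gcongr
    _ = k ^ j * (β ^ i * (G.goodColorings x k (S \ R)).card) := by ring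
    _ ≤ k ^ j * (k ^ i * (G.goodColorings x k S).card) := by gcongr
    _ = k ^ (i + j) * (G.goodColorings x k S).card := by ring

/-- A cycle through `v` in which only two colors occur splits into an alternating path from `v` of
even length and a further common neighbor of the ends of that path. -/
theorem exists_alternating_path {x : ℝ} {α : Type*} [DecidableEq α] {U : Finset V} {c : V → α}
    (hc : ∀ u ∈ U, ∀ w ∈ U, G.Conflict x u w → c u ≠ c w) {v : V} (w : G.Walk v v)
    (hw : w.IsCycle) (hU : ∀ y ∈ w.support, y ∈ U) {C : Finset α} (hC : C.card ≤ 2)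
    (hwC : ∀ y ∈ w.support, c y ∈ C) :
    ∃ m, 1 ≤ m ∧ ∃ u, ∃ p : G.Walk v u, p.IsPath ∧ p.length = 2 * m ∧
      ∃ z ∈ G.commonNeighborFinset v u, u ≠ v ∧ ¬ G.Conflict x v u ∧ z ∉ p.support ∧
        ∀ i ≤ 2 * m, c (p.getVert i) = if Even i then c u else c z := by
  cases w with
  | nil => exact absurd rfl hw.ne_nil
  | @cons _ z _ h q =>
    cases q with
    | nil => exact absurd h (G.loopless.irrefl v)
    | @cons _ u _ h' q' =>
      rw [Walk.cons_isCycle_iff, Walk.cons_isPath_iff] at hw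
      obtain ⟨⟨hq', hz⟩, hvz⟩ := hw
      have huv : u ≠ v := by
        rintro rfl
        simp [Sym2.eq_swap] at hvz
      simp only [Walk.support_cons, List.mem_cons, forall_eq_or_imp] at hU hwC
      obtain ⟨hvU, hzU, hU⟩ := hU
      obtain ⟨hvC, hzC, hC'⟩ := hwC
      have hvz' : c v ≠ c z := hc v hvU z hzU (Or.inl h)
      have hCeq : ({c v, c z} : Finset α) = C := Finset.eq_of_subset_of_card_le
        (by simp [Finset.insert_subset_iff, hvC, hzC]) (by rwa [Finset.card_pair hvz'])
      set p := q'.reverse with hp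
      have hpU : ∀ y ∈ p.support, y ∈ U := fun y hy => hU y (by simpa [hp] using hy)
      have hpC : ∀ y ∈ p.support, c y = c v ∨ c y = c z := fun y hy => by
        simpa [← hCeq] using hC' y (by simpa [hp] using hy)
      have halt : ∀ i ≤ p.length, c (p.getVert i) = if Even i then c v else c z := by
        intro i
        induction i with
        | zero => simp
        | succ i ih =>
          intro hi
          have h1 := ih (by omega)
          have h2 := hc _ (hpU _ (p.getVert_mem_support i)) _
            (hpU _ (p.getVert_mem_support (i + 1))) (Or.inl (p.adj_getVert_succ (by omega)))
          have h3 := hpC _ (p.getVert_mem_support (i + 1))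
          rw [h1] at h2
          by_cases hi : Even i
          · simp only [hi, Nat.even_add_one, if_true, not_true, if_false] at h2 ⊢
            exact h3.resolve_left h2.symm
          · simp only [hi, Nat.even_add_one, if_true, not_false_iff, if_false] at h2 ⊢
            exact h3.resolve_right h2.symm
      have huU : u ∈ U := hpU u p.end_mem_support
      have hcu : c u = c v := (hpC u p.end_mem_support).resolve_right
        (hc z hzU u huU (Or.inl h')).symm
      have heven : Even p.length := by
        by_contra hodd
        have := halt p.length le_rfl
        rw [p.getVert_length, if_neg hodd, hcu] at this
        exact hvz' this
      obtain ⟨m, hm⟩ := heven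
      refine ⟨m, ?_, u, p, by simpa [hp] using hq', by omega, z,
        G.mem_commonNeighborFinset.2 ⟨h, h'.symm⟩, huv,
        fun hcon => hc v hvU u huU hcon hcu.symm, by simpa [hp] using hz, fun i hi => ?_⟩
      · by_contra hm0
        exact huv (Walk.eq_of_length_eq_zero (p := p) (by omega)).symm
      · rw [halt i (by omega), hcu]

theorem exists_alternating_path_of_notMem {x : ℝ} {k : ℕ} {S : Finset V} {v : V} (hv : v ∉ S)
    {c : V → Fin k} (hc : c ∈ G.goodColorings x k S)
    (hc' : c ∉ G.goodColorings x k (insert v S)) :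
    (∃ u, G.Conflict x v u ∧ c v = c u) ∨
    ∃ m, 1 ≤ m ∧ ∃ u, ∃ p : G.Walk v u, p.IsPath ∧ p.length = 2 * m ∧
      ∃ z ∈ G.commonNeighborFinset v u, u ≠ v ∧ ¬ G.Conflict x v u ∧ z ∉ p.support ∧
        ∀ i ≤ 2 * m, c (p.getVert i) = if Even i then c u else c z := by
  by_cases hcon : ∃ u, G.Conflict x v u ∧ c v = c u
  · exact Or.inl hcon
  refine Or.inr ?_
  push Not at hcon
  rw [mem_goodColorings] at hc hc'
  have hconf : ∀ u ∈ insert v S, ∀ w ∈ insert v S, G.Conflict x u w → c u ≠ c w := by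
    intro u hu w hw huw
    rcases Finset.mem_insert.1 hu with rfl | hu
    · exact hcon w huw
    rcases Finset.mem_insert.1 hw with rfl | hw
    · exact (hcon u huw.symm).symm
    exact hc.1 u hu w hw huw
  rw [not_and] at hc'
  have hcyc := hc' hconf
  push Not at hcyc
  obtain ⟨v₀, w, hw, hwS, hcard⟩ := hcyc
  have hvw : v ∈ w.support := by
    by_contra hvw
    refine absurd (hc.2 v₀ w hw fun y hy => ?_) hcard.not_ge
    exact (Finset.mem_insert.1 (hwS y hy)).resolve_left fun h => hvw (h ▸ hy)
  have hsupp : ∀ y ∈ (w.rotate v hvw).support, y ∈ w.support := fun y hy =>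
    (w.mem_support_rotate_iff v hvw).1 hy
  exact G.exists_alternating_path hconf (w.rotate v hvw) (hw.rotate hvw)
    (fun y hy => hwS y (hsupp y hy)) (C := (w.support.map c).toFinset) (by omega)
    fun y hy => by simpa using ⟨y, hsupp y hy, rfl⟩

open Classical in
/-- The good colorings on `S` that satisfy the predicate `P`. -/
noncomputable def goodColoringsWith (x : ℝ) (k : ℕ) (S : Finset V) (P : (V → Fin k) → Prop) :
    Finset (V → Fin k) :=
  (G.goodColorings x k S).filter P

theorem mem_goodColoringsWith {x : ℝ} {k : ℕ} {S : Finset V} {P : (V → Fin k) → Prop}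
    {c : V → Fin k} :
    c ∈ G.goodColoringsWith x k S P ↔ c ∈ G.goodColorings x k S ∧ P c := by
  simp [goodColoringsWith]

theorem goodColoringsWith_subset (x : ℝ) {k : ℕ} (S : Finset V) (P : (V → Fin k) → Prop) :
    G.goodColoringsWith x k S P ⊆ G.goodColorings x k S :=
  fun _ hc => (G.mem_goodColoringsWith.1 hc).1

theorem card_goodColoringsWith_exists_le_sum {ι : Type*} (x : ℝ) {k : ℕ} (S : Finset V)
    (I : Finset ι) (P : ι → (V → Fin k) → Prop) (f : ι → ℝ)
    (h : ∀ i ∈ I, ((G.goodColoringsWith x k S (P i)).card : ℝ) ≤ f i) :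
    ((G.goodColoringsWith x k S fun c => ∃ i ∈ I, P i c).card : ℝ) ≤ ∑ i ∈ I, f i := by
  classical
  have hsub : (G.goodColoringsWith x k S fun c => ∃ i ∈ I, P i c) ⊆
      I.biUnion fun i => G.goodColoringsWith x k S (P i) := by
    intro c hc
    simp only [mem_goodColoringsWith, Finset.mem_biUnion] at hc ⊢
    obtain ⟨hc, i, hi, hP⟩ := hc
    exact ⟨i, hi, hc, hP⟩
  calc ((G.goodColoringsWith x k S fun c => ∃ i ∈ I, P i c).card : ℝ)
      ≤ ∑ i ∈ I, ((G.goodColoringsWith x k S (P i)).card : ℝ) := by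
        exact_mod_cast (Finset.card_le_card hsub).trans Finset.card_biUnion_le
    _ ≤ ∑ i ∈ I, f i := Finset.sum_le_sum h

section Extension

variable {x β : ℝ} {k : ℕ} {S : Finset V} {v : V}

theorem card_goodColoringsWith_eq_color_le (hβ : 0 ≤ β) (hβk : β ≤ k) (hk : 0 < k)
    (ih : ∀ S' ⊂ S, ∀ v ∉ S', β * (G.goodColorings x k S').card ≤
      k * (G.goodColorings x k (insert v S')).card)
    (hvS : v ∉ S) {u : V} (hu : u ≠ v) :
    ((G.goodColoringsWith x k S fun c => c v = c u).card : ℝ) ≤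
      (G.goodColorings x k S).card / k := by
  have hk' : (0 : ℝ) < k := by exact_mod_cast hk
  have := G.card_mul_le_of_determined hβ hβk hk ih hvS (Finset.notMem_empty v)
    (G.goodColoringsWith_subset x S (fun c : V → Fin k => c v = c u)) (by
      intro c hc c' hc' h
      rw [mem_goodColoringsWith] at hc hc'
      funext y
      by_cases hy : y = v
      · rw [hy, hc.2, hc'.2]
        exact h u (by simpa using hu)
      · exact h y (by simpa using hy))
  rw [le_div_iff₀ hk']
  simpa using this

theorem card_goodColoringsWith_pair_le (hβ : 0 < β) (hβk : β ≤ k) (hk : 0 < k)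
    (ih : ∀ S' ⊂ S, ∀ v ∉ S', β * (G.goodColorings x k S').card ≤
      k * (G.goodColorings x k (insert v S')).card)
    (hvS : v ∉ S) {u : V} (hu : u ≠ v) {e : Finset V}
    (he : e ∈ (G.commonNeighborFinset v u).powersetCard 2) :
    ((G.goodColoringsWith x k S fun c =>
      c v = c u ∧ ∀ y ∈ e, ∀ y' ∈ e, c y = c y').card : ℝ) ≤
      (G.goodColorings x k S).card / k / β := by
  have hk' : (0 : ℝ) < k := by exact_mod_cast hk
  rw [Finset.mem_powersetCard] at he
  obtain ⟨a, b, hab, rfl⟩ := Finset.card_eq_two.1 he.2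
  have ha := G.mem_commonNeighborFinset.1 (he.1 (by simp : a ∈ ({a, b} : Finset V)))
  have hb := G.mem_commonNeighborFinset.1 (he.1 (by simp : b ∈ ({a, b} : Finset V)))
  have := G.card_mul_le_of_determined hβ.le hβk hk ih hvS
    (by simpa using ha.1.ne : v ∉ ({a} : Finset V))
    (G.goodColoringsWith_subset x S (fun c : V → Fin k =>
      c v = c u ∧ ∀ y ∈ ({a, b} : Finset V), ∀ y' ∈ ({a, b} : Finset V), c y = c y')) (by
      intro c hc c' hc' h
      rw [mem_goodColoringsWith] at hc hc'
      funext y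
      by_cases hy : y = v
      · rw [hy, hc.2.1, hc'.2.1]
        exact h u (by simpa using ⟨hu, ha.2.ne⟩)
      by_cases hya : y = a
      · rw [hya, hc.2.2 a (by simp) b (by simp), hc'.2.2 a (by simp) b (by simp)]
        exact h b (by simpa using ⟨hb.1.ne', hab.symm⟩)
      exact h y (by simpa using ⟨hy, hya⟩))
  rw [div_div, le_div_iff₀ (by positivity)]
  simpa using this

/-- The coloring `c` alternates on the path `p` of length `2 * m`, which avoids `z`, between the
color of its end and the color of `z`. -/
def Walk.AlternatesWith {G : SimpleGraph V} {α : Type*} {u : V} (p : G.Walk v u) (m : ℕ) (z : V)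
    (c : V → α) : Prop :=
  p.IsPath ∧ p.length = 2 * m ∧ z ∉ p.support ∧
    ∀ i ≤ 2 * m, c (p.getVert i) = if Even i then c u else c z

theorem card_goodColoringsWith_alternatesWith_le (hβ : 0 < β) (hβk : β ≤ k) (hk : 0 < k)
    (ih : ∀ S' ⊂ S, ∀ v ∉ S', β * (G.goodColorings x k S').card ≤
      k * (G.goodColorings x k (insert v S')).card)
    (hvS : v ∉ S) {u : V} (hu : u ≠ v) (p : G.Walk v u) (m : ℕ) (z : V) :
    ((G.goodColoringsWith x k S fun c => p.AlternatesWith m z c).card : ℝ) ≤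
      (G.goodColorings x k S).card / k / β ^ (2 * m - 1) := by
  have hk' : (0 : ℝ) < k := by exact_mod_cast hk
  by_cases hp : p.IsPath ∧ p.length = 2 * m ∧ z ∉ p.support
  swap
  · have hempty : (G.goodColoringsWith x k S fun c => p.AlternatesWith m z c) = ∅ := by
      refine Finset.eq_empty_of_forall_notMem fun c hc => ?_
      obtain ⟨-, h1, h2, h3, -⟩ := G.mem_goodColoringsWith.1 hc
      exact hp ⟨h1, h2, h3⟩
    simp only [hempty, Finset.card_empty, Nat.cast_zero]
    positivity
  obtain ⟨hpath, hlen, hz⟩ := hp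
  set R := (p.support.toFinset.erase u).erase v with hR
  have hRcard : R.card = 2 * m - 1 := by
    rw [hR, Finset.card_erase_of_mem (by simpa using hu.symm), Finset.card_erase_of_mem (by simp),
      List.toFinset_card_of_nodup hpath.support_nodup, Walk.length_support]
    omega
  have huR : u ∉ insert v R := by simp [hR, hu]
  have hzR : z ∉ insert v R := by
    have : z ≠ v := fun h => hz (h ▸ p.start_mem_support)
    simp [hR, hz, this]
  have := G.card_mul_le_of_determined hβ.le hβk hk ih hvS (by simp [hR] : v ∉ R)
    (G.goodColoringsWith_subset x S (fun c : V → Fin k => p.AlternatesWith m z c)) (by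
      intro c hc c' hc' h
      rw [mem_goodColoringsWith] at hc hc'
      funext y
      by_cases hy : y ∈ p.support
      · obtain ⟨i, rfl, hi⟩ := Walk.mem_support_iff_exists_getVert.1 hy
        rw [hc.2.2.2.2 i (by omega), hc'.2.2.2.2 i (by omega), h u huR, h z hzR]
      · refine h y ?_
        have : y ≠ v := fun h => hy (h ▸ p.start_mem_support)
        simp [hR, hy, this])
  rw [div_div, le_div_iff₀ (by positivity), ← hRcard]
  exact this

open Classical in
theorem card_goodColorings_le_add {Δ : ℕ} (hΔ : ∀ v, G.degree v ≤ Δ) (hx : 0 ≤ x) (hβ : 0 < β)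
    (hβk : β ≤ k) (hk : 0 < k)
    (ih : ∀ S' ⊂ S, ∀ v ∉ S', β * (G.goodColorings x k S').card ≤
      k * (G.goodColorings x k (insert v S')).card)
    (hvS : v ∉ S) :
    ((G.goodColorings x k S).card : ℝ) ≤ (G.goodColorings x k (insert v S)).card +
      (G.goodColorings x k S).card / k *
        ((Finset.univ.filter (G.Conflict x v)).card +
          (∑ u ∈ Finset.univ.filter (fun u => u ≠ v ∧ ¬ G.Conflict x v u),
            ((G.commonNeighborFinset v u).card.choose 2 : ℝ) / β) +
          ∑ m ∈ Finset.Icc 2 (Fintype.card V), (Δ : ℝ) ^ (2 * m) * x / β ^ (2 * m - 1)) := by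
  set s := G.goodColorings x k S
  set F := Finset.univ.filter (fun u => u ≠ v ∧ ¬ G.Conflict x v u) with hF
  set g : ℝ := s.card / k with hg
  have hg0 : 0 ≤ g := by positivity
  have h1 := G.card_goodColoringsWith_exists_le_sum x S (Finset.univ.filter (G.Conflict x v))
    (fun u c => c v = c u) (fun _ => g) fun u hu => by
      refine G.card_goodColoringsWith_eq_color_le hβ.le hβk hk ih hvS ?_
      rcases (Finset.mem_filter.1 hu).2 with h | h
      · exact h.ne'
      · exact h.1.symm
  have h2 := G.card_goodColoringsWith_exists_le_sum x S F
    (fun u c => ∃ e ∈ (G.commonNeighborFinset v u).powersetCard 2,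
      c v = c u ∧ ∀ y ∈ e, ∀ y' ∈ e, c y = c y')
    (fun u => g * ((G.commonNeighborFinset v u).card.choose 2 / β)) fun u hu => by
      refine (G.card_goodColoringsWith_exists_le_sum x S _ _ (fun _ => g / β) fun e he =>
        G.card_goodColoringsWith_pair_le hβ hβk hk ih hvS (Finset.mem_filter.1 hu).2.1 he).trans
        (le_of_eq ?_)
      rw [Finset.sum_const, Finset.card_powersetCard, nsmul_eq_mul]
      ring
  have h3 := G.card_goodColoringsWith_exists_le_sum x S (Finset.Icc 2 (Fintype.card V))
    (fun m c => ∃ u ∈ F, ∃ p ∈ G.finsetWalkLength (2 * m) v u,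
      ∃ z ∈ G.commonNeighborFinset v u, p.AlternatesWith m z c)
    (fun m => g * ((Δ : ℝ) ^ (2 * m) * x / β ^ (2 * m - 1))) fun m _ => by
      have hinner : ∀ u ∈ F, ∀ p ∈ G.finsetWalkLength (2 * m) v u,
          ((G.goodColoringsWith x k S fun c => ∃ z ∈ G.commonNeighborFinset v u,
            p.AlternatesWith m z c).card : ℝ) ≤ x * (g / β ^ (2 * m - 1)) := by
        intro u hu p _
        obtain ⟨huv, hcon⟩ := (Finset.mem_filter.1 hu).2
        refine (G.card_goodColoringsWith_exists_le_sum x S _ _ (fun _ => g / β ^ (2 * m - 1)) fun z _ =>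
          G.card_goodColoringsWith_alternatesWith_le hβ hβk hk ih hvS huv p m z).trans ?_
        rw [Finset.sum_const, nsmul_eq_mul]
        have : ((G.commonNeighborFinset v u).card : ℝ) ≤ x :=
          not_lt.1 fun h => hcon (Or.inr ⟨huv.symm, h⟩)
        gcongr
      refine (G.card_goodColoringsWith_exists_le_sum x S F _
        (fun u => (G.finsetWalkLength (2 * m) v u).card * (x * (g / β ^ (2 * m - 1))))
        fun u hu => (G.card_goodColoringsWith_exists_le_sum x S _ _ _ (hinner u hu)).trans
          (by simp)).trans ?_
      rw [← Finset.sum_mul]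
      have hsum : (∑ u ∈ F, ((G.finsetWalkLength (2 * m) v u).card : ℝ)) ≤ (Δ : ℝ) ^ (2 * m) := by
        exact_mod_cast (Finset.sum_le_sum_of_subset (Finset.subset_univ F)).trans
          (G.sum_card_finsetWalkLength_le hΔ (2 * m) v)
      calc _ ≤ (Δ : ℝ) ^ (2 * m) * (x * (g / β ^ (2 * m - 1))) := by gcongr
        _ = _ := by ring
  rw [← Finset.mul_sum] at h2 h3
  rw [Finset.sum_const, nsmul_eq_mul] at h1
  have hcover : s ⊆ G.goodColorings x k (insert v S) ∪
      ((G.goodColoringsWith x k S fun c => ∃ u ∈ Finset.univ.filter (G.Conflict x v), c v = c u) ∪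
      ((G.goodColoringsWith x k S fun c => ∃ u ∈ F, ∃ e ∈ (G.commonNeighborFinset v u).powersetCard 2,
        c v = c u ∧ ∀ y ∈ e, ∀ y' ∈ e, c y = c y') ∪
      (G.goodColoringsWith x k S fun c => ∃ m ∈ Finset.Icc 2 (Fintype.card V), ∃ u ∈ F,
        ∃ p ∈ G.finsetWalkLength (2 * m) v u,
          ∃ z ∈ G.commonNeighborFinset v u, p.AlternatesWith m z c))) := by
    intro c hc
    simp only [Finset.mem_union, or_iff_not_imp_left]
    intro hc'
    rcases G.exists_alternating_path_of_notMem hvS hc hc' with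
      ⟨u, hu⟩ | ⟨m, hm, u, p, hp, hlen, z, hz, huv, hcon, hzp, halt⟩
    · exact fun h => absurd (G.mem_goodColoringsWith.2 ⟨hc, u, by simpa using hu.1, hu.2⟩) h
    · refine fun _ h => ?_
      have huF : u ∈ F := by simp [hF, huv, hcon]
      have hlt := hp.length_lt
      refine G.mem_goodColoringsWith.2 ⟨hc, m, Finset.mem_Icc.2 ⟨?_, by omega⟩, u, huF, p,
        G.mem_finsetWalkLength_iff.2 hlen, z, hz, hp, hlen, hzp, halt⟩
      by_contra hm2
      obtain rfl : m = 1 := by omega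
      refine h (G.mem_goodColoringsWith.2 ⟨hc, u, huF, {p.getVert 1, z}, ?_, ?_, ?_⟩)
      · have hne : p.getVert 1 ≠ z := fun h => hzp (h ▸ p.getVert_mem_support 1)
        have h1 := p.adj_getVert_succ (i := 0) (by omega)
        have h2 := p.adj_getVert_succ (i := 1) (by omega)
        rw [show 1 + 1 = p.length by omega, p.getVert_length] at h2
        rw [p.getVert_zero] at h1
        rw [Finset.mem_powersetCard, Finset.card_pair hne]
        refine ⟨?_, rfl⟩
        simp [Finset.insert_subset_iff, hz, mem_commonNeighborFinset, h2.symm]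
        simpa using h1
      · simpa using halt 0 (by omega)
      · have h1 : c (p.getVert 1) = c z := by simpa using halt 1 (by omega)
        simp [h1]
  have hcard := (Finset.card_le_card hcover).trans ((Finset.card_union_le _ _).trans
    (add_le_add le_rfl ((Finset.card_union_le _ _).trans
      (add_le_add le_rfl (Finset.card_union_le _ _)))))
  rify at hcard
  linarith

end Extension

open Classical in
theorem card_conflict_add_sum_choose_le {Δ : ℕ} (hΔ : ∀ v, G.degree v ≤ Δ) {x : ℝ} (hx : 0 < x)
    (hΔx : (Δ : ℝ) ^ 2 = x ^ 3) (v : V) :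
    ((Finset.univ.filter (G.Conflict x v)).card : ℝ) +
      (∑ u ∈ Finset.univ.filter (fun u => u ≠ v ∧ ¬ G.Conflict x v u),
        ((G.commonNeighborFinset v u).card.choose 2 : ℝ) / (x ^ 2 / 2)) ≤ Δ + x ^ 2 := by
  rw [Finset.card_filter, Finset.sum_filter]
  push_cast
  rw [← Finset.sum_add_distrib]
  calc _ ≤ ∑ u, ((if G.Adj v u then (1 : ℝ) else 0) + (G.commonNeighborFinset v u).card / x) := by
        refine Finset.sum_le_sum fun u _ => ?_
        set d := (G.commonNeighborFinset v u).card with hd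
        have hdx : (0 : ℝ) ≤ d / x := by positivity
        by_cases hcon : G.Conflict x v u
        · simp only [hcon, if_true, not_true, and_false, if_false, add_zero]
          rcases hcon with h | ⟨-, h⟩
          · simp [h, hdx]
          · have : (1 : ℝ) ≤ d / x := by rw [le_div_iff₀ hx]; linarith
            split_ifs <;> linarith
        · have hadj : ¬ G.Adj v u := fun h => hcon (Or.inl h)
          simp only [hcon, if_false, not_false_iff, and_true, zero_add, hadj]
          split_ifs with huv
          · have hd' : (d : ℝ) ≤ x := not_lt.1 fun h => hcon (Or.inr ⟨huv.symm, h⟩)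
            rw [Nat.cast_choose_two, div_le_div_iff₀ (by positivity) hx]
            have hd0 : (0 : ℝ) ≤ d := Nat.cast_nonneg d
            nlinarith [mul_nonneg (mul_nonneg hd0 hx.le) (sub_nonneg.2 hd'), mul_nonneg hd0 hx.le]
          · exact hdx
    _ = G.degree v + (∑ u, ((G.commonNeighborFinset v u).card : ℝ)) / x := by
        rw [Finset.sum_add_distrib, ← Finset.sum_div, Finset.sum_boole, ← card_neighborFinset_eq_degree,
          neighborFinset_eq_filter]
    _ ≤ Δ + (Δ : ℝ) ^ 2 / x := by
        have h1 : (∑ u, ((G.commonNeighborFinset v u).card : ℝ)) ≤ (Δ : ℝ) ^ 2 := by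
          exact_mod_cast G.sum_card_commonNeighborFinset_le hΔ v
        have h2 : (G.degree v : ℝ) ≤ Δ := by exact_mod_cast hΔ v
        gcongr
    _ = Δ + x ^ 2 := by
        rw [hΔx]
        field_simp

theorem sum_pow_mul_div_pow_le {d x : ℝ} (hx : 4 < x) (hdx : d ^ 2 = x ^ 3) (n : ℕ) :
    ∑ m ∈ Finset.Icc 2 n, d ^ (2 * m) * x / (x ^ 2 / 2) ^ (2 * m - 1) ≤
      8 * x ^ 2 / (x - 4) := by
  have hx0 : 0 < x := by linarith
  calc ∑ m ∈ Finset.Icc 2 n, d ^ (2 * m) * x / (x ^ 2 / 2) ^ (2 * m - 1)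
      = x ^ 3 / 2 * ∑ m ∈ Finset.Ico 2 (n + 1), (4 / x) ^ m := by
        rw [Finset.Ico_add_one_right_eq_Icc, Finset.mul_sum]
        refine Finset.sum_congr rfl fun m hm => ?_
        obtain ⟨j, rfl⟩ := Nat.exists_eq_add_of_le (Finset.mem_Icc.1 hm).1
        have h1 : (x ^ 3) ^ (2 + j) = x ^ 6 * (x ^ j) ^ 3 := by ring
        have h2 : (x ^ 2 / 2) ^ (3 + 2 * j) = x ^ 6 / 8 * ((x ^ j) ^ 4 / 4 ^ j) := by
          rw [pow_add, pow_mul, show (x ^ 2 / 2) ^ 2 = x ^ 4 / 4 by ring, div_pow _ _ j]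
          ring
        rw [show 2 * (2 + j) - 1 = 3 + 2 * j by omega, pow_mul, hdx, h1, h2, pow_add, div_pow _ _ j]
        field_simp
        ring
    _ ≤ x ^ 3 / 2 * ((4 / x) ^ 2 / (1 - 4 / x)) := by
        gcongr
        exact geom_sum_Ico_le_of_lt_one (by positivity) ((div_lt_one hx0).2 hx)
    _ = 8 * x ^ 2 / (x - 4) := by
        have h1 : x - 4 ≠ 0 := by linarith
        have h2 : 1 - 4 / x ≠ 0 := by
          rw [one_sub_div hx0.ne']
          positivity
        field_simp
        ring

theorem mul_card_goodColorings_le {Δ : ℕ} (hΔ : ∀ v, G.degree v ≤ Δ) {x : ℝ} (hx : 4 < x)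
    (hΔx : (Δ : ℝ) ^ 2 = x ^ 3) {k : ℕ}
    (hk : 3 / 2 * x ^ 2 + Δ + 8 * x ^ 2 / (x - 4) ≤ k) (S : Finset V) :
    ∀ v ∉ S, x ^ 2 / 2 * (G.goodColorings x k S).card ≤
      k * (G.goodColorings x k (insert v S)).card := by
  classical
  induction S using Finset.strongInduction with
  | H S ih =>
    intro v hv
    have hx4 : 0 < x - 4 := by linarith
    have hβ : 0 < x ^ 2 / 2 := by positivity
    have hnonneg : 0 ≤ x ^ 2 + Δ + 8 * x ^ 2 / (x - 4) := by positivity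
    have hβk : x ^ 2 / 2 ≤ k := by linarith
    have hk0 : (0 : ℝ) < k := by linarith
    have h := G.card_goodColorings_le_add hΔ (by linarith) hβ hβk (by exact_mod_cast hk0) ih hv
    have h1 := G.card_conflict_add_sum_choose_le hΔ (by linarith) hΔx v
    have h2 := sum_pow_mul_div_pow_le hx hΔx (Fintype.card V)
    set g : ℝ := ((G.goodColorings x k S).card : ℝ)
    have h3 : g ≤ (G.goodColorings x k (insert v S)).card + g / k * (k - x ^ 2 / 2) := by
      refine h.trans ?_
      gcongr
      linarith
    calc x ^ 2 / 2 * g = (k : ℝ) * (g - g / k * (k - x ^ 2 / 2)) := by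
          have := hk0.ne'
          field_simp
          ring
      _ ≤ (k : ℝ) * ((G.goodColorings x k (insert v S)).card : ℝ) := by
          gcongr
          linarith

theorem exists_isAcyclicColoring {Δ : ℕ} (hΔ : ∀ v, G.degree v ≤ Δ) {x : ℝ} (hx : 4 < x)
    (hΔx : (Δ : ℝ) ^ 2 = x ^ 3) {k : ℕ}
    (hk : 3 / 2 * x ^ 2 + Δ + 8 * x ^ 2 / (x - 4) ≤ k) :
    ∃ c : V → Fin k, IsAcyclicColoring G c := by
  have hx4 : 0 < x - 4 := by linarith
  have hk0 : (0 : ℝ) < k := lt_of_lt_of_le (by positivity) hk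
  have h := G.pow_mul_card_goodColorings_sdiff_le (β := x ^ 2 / 2) (by positivity)
    (fun S' (_ : S' ⊂ Finset.univ) => G.mul_card_goodColorings_le hΔ hx hΔx hk S')
    (Finset.Subset.refl Finset.univ)
  rw [Finset.sdiff_self, goodColorings_empty] at h
  have hpos : (0 : ℝ) < (x ^ 2 / 2) ^ (Finset.univ : Finset V).card *
      (Finset.univ : Finset (V → Fin k)).card := by
    have : 0 < k := by exact_mod_cast hk0
    simp only [Finset.card_univ, Fintype.card_fun, Fintype.card_fin]
    positivity
  have hcard : (0 : ℝ) < (G.goodColorings x k Finset.univ).card :=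
    pos_of_mul_pos_right (hpos.trans_le h) (by positivity)
  obtain ⟨c, hc⟩ := Finset.card_pos.1 (Nat.cast_pos.1 hcard)
  exact ⟨c, G.isAcyclicColoring_of_mem_goodColorings_univ hc⟩

end SimpleGraph

theorem stmt1 {V : Type} [Fintype V] (G : SimpleGraph V) [DecidableRel G.Adj]
    (Δ : ℕ) (hΔ : G.maxDegree = Δ) (h9 : 9 ≤ Δ) :
    (acyclicChromaticNumber G : ℝ) <
      (3 / 2) * (Δ : ℝ) ^ ((4 : ℝ) / 3) + (Δ : ℝ)
        + 8 * (Δ : ℝ) ^ ((4 : ℝ) / 3) / ((Δ : ℝ) ^ ((2 : ℝ) / 3) - 4) + 1 := by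
  classical
  have hΔ0 : (0 : ℝ) ≤ Δ := Nat.cast_nonneg Δ
  have h9' : (9 : ℝ) ≤ Δ := by exact_mod_cast h9
  set x : ℝ := (Δ : ℝ) ^ ((2 : ℝ) / 3) with hx
  have hx2 : (Δ : ℝ) ^ ((4 : ℝ) / 3) = x ^ 2 := by
    rw [hx, ← Real.rpow_mul_natCast hΔ0]
    norm_num
  have hx3 : (Δ : ℝ) ^ 2 = x ^ 3 := by
    rw [hx, ← Real.rpow_mul_natCast hΔ0]
    norm_num
  have hx4 : 4 < x := by
    refine lt_of_pow_lt_pow_left₀ 3 (by positivity) ?_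
    rw [← hx3]
    nlinarith
  have hx4' : 0 < x - 4 := by linarith
  rw [hx2]
  set k := ⌈3 / 2 * x ^ 2 + Δ + 8 * x ^ 2 / (x - 4)⌉₊ with hk
  have hcol := G.exists_isAcyclicColoring (fun v => hΔ ▸ G.degree_le_maxDegree v) hx4 hx3
    (Nat.le_ceil _ : _ ≤ (k : ℝ))
  have hle : acyclicChromaticNumber G ≤ k := Nat.sInf_le hcol
  calc (acyclicChromaticNumber G : ℝ) ≤ k := by exact_mod_cast hle
    _ < 3 / 2 * x ^ 2 + Δ + 8 * x ^ 2 / (x - 4) + 1 := Nat.ceil_lt_add_one (by positivity)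
end

section
/- Every graph G with maximum degree Δ ≥ 3 satisfies π_l(G) ≤ ⌈ Δ² + (3/2^(2/3))·Δ^(5/3) + 2^(2/3)·Δ^(5/3)/(Δ^(1/3) − 2^(1/3)) ⌉, where π_l(G) is the nonrepetitive choice number of G. -/
/-- A vertex coloring is nonrepetitive if for every path `v_1, …, v_{2j}` (`j ≥ 1`)
in `G`, the sequence of colors of the first half differs from that of the second half. -/
def IsNonrepetitiveColoring {V : Type} (G : SimpleGraph V) (c : V → ℕ) : Prop :=
  ∀ j : ℕ, 1 ≤ j → ∀ p : ℕ → V,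
    (∀ i, i + 1 < 2 * j → G.Adj (p i) (p (i + 1))) →
    (∀ i₁ i₂, i₁ < 2 * j → i₂ < 2 * j → i₁ ≠ i₂ → p i₁ ≠ p i₂) →
    ∃ i < j, c (p i) ≠ c (p (i + j))

/-- The nonrepetitive choice number: the least `k` such that for every assignment of
lists of size `k` to the vertices there is a nonrepetitive coloring from the lists. -/
noncomputable def nonrepetitiveChoiceNumber {V : Type} (G : SimpleGraph V) : ℕ :=
  sInf {k | ∀ L : V → Finset ℕ, (∀ v, (L v).card = k) →
    ∃ c : V → ℕ, (∀ v, c v ∈ L v) ∧ IsNonrepetitiveColoring G c}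

open Finset

/-- `G`-paths on `2 * j` vertices inside `S` are not coloured repetitively by `c`. -/
def NonrepetitiveOn {V : Type} (G : SimpleGraph V) (S : Finset V) (c : V → ℕ) : Prop :=
  ∀ j : ℕ, 1 ≤ j → ∀ p : ℕ → V,
    (∀ i, i + 1 < 2 * j → G.Adj (p i) (p (i + 1))) →
    (∀ i₁ i₂, i₁ < 2 * j → i₂ < 2 * j → i₁ ≠ i₂ → p i₁ ≠ p i₂) →
    (∀ i, i < 2 * j → p i ∈ S) →
    ∃ i < j, c (p i) ≠ c (p (i + j))

open Classical in
/-- The nonrepetitive colorings of `S` from the lists `L`, extended by zero outside `S`. -/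
noncomputable def listColorings {V : Type} [Fintype V] (G : SimpleGraph V) (L : V → Finset ℕ)
    (S : Finset V) : Finset (V → ℕ) :=
  (Fintype.piFinset fun v => if v ∈ S then L v else {0}).filter (NonrepetitiveOn G S)

theorem NonrepetitiveOn.mono {V : Type} {G : SimpleGraph V} {S T : Finset V} {c c' : V → ℕ}
    (h : NonrepetitiveOn G T c) (hST : S ⊆ T) (hc : ∀ v ∈ S, c' v = c v) :
    NonrepetitiveOn G S c' := by
  intro j hj p hadj hinj hS
  obtain ⟨i, hi, hne⟩ := h j hj p hadj hinj fun i hi => hST (hS i hi)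
  refine ⟨i, hi, ?_⟩
  rwa [hc _ (hS i (by omega)), hc _ (hS (i + j) (by omega))]

theorem mem_listColorings {V : Type} [Fintype V] {G : SimpleGraph V} {L : V → Finset ℕ}
    {S : Finset V} {c : V → ℕ} :
    c ∈ listColorings G L S ↔
      (∀ v ∈ S, c v ∈ L v) ∧ (∀ v, v ∉ S → c v = 0) ∧ NonrepetitiveOn G S c := by
  classical
  simp only [listColorings, mem_filter, Fintype.mem_piFinset]
  constructor
  · rintro ⟨h, hn⟩
    refine ⟨fun v hv => by simpa [hv] using h v, fun v hv => by simpa [hv] using h v, hn⟩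
  · rintro ⟨h, h0, hn⟩
    refine ⟨fun v => ?_, hn⟩
    by_cases hv : v ∈ S
    · simpa [hv] using h v hv
    · simpa [hv] using h0 v hv

/-- There are at most `Δ ^ m` walks of length `m` whose `i`-th vertex is `v`. -/
theorem exists_finset_walks {V : Type} [Fintype V] (G : SimpleGraph V) [DecidableRel G.Adj]
    {Δ : ℕ} (hdeg : ∀ v, G.degree v ≤ Δ) (hΔ : 0 < Δ) (m i : ℕ) (v : V) :
    ∃ F : Finset (ℕ → V), F.card ≤ Δ ^ m ∧ ∀ p : ℕ → V, i ≤ m → p i = v →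
      (∀ t < m, G.Adj (p t) (p (t + 1))) → (∀ t, m < t → p t = v) → p ∈ F := by
  classical
  have hd : ∀ u, ∃ d : V → Fin Δ, ∀ w w', G.Adj u w → G.Adj u w' → d w = d w' → w = w' := by
    intro u
    have : Fintype.card (G.neighborFinset u) ≤ Fintype.card (Fin Δ) := by
      rw [Fintype.card_coe, Fintype.card_fin]
      exact hdeg u
    obtain ⟨e⟩ := Function.Embedding.nonempty_of_card_le this
    refine ⟨fun w => if h : w ∈ G.neighborFinset u then e ⟨w, h⟩ else ⟨0, hΔ⟩, ?_⟩
    intro w w' hw hw' h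
    have hw1 : w ∈ G.neighborFinset u := by simpa using hw
    have hw2 : w' ∈ G.neighborFinset u := by simpa using hw'
    simp only [hw1, hw2, dite_true] at h
    simpa using e.injective h
  choose d hd using hd
  let W : Set (ℕ → V) := {p | i ≤ m ∧ p i = v ∧ (∀ t < m, G.Adj (p t) (p (t + 1))) ∧
    ∀ t, m < t → p t = v}
  let code : (ℕ → V) → (Fin m → Fin Δ) := fun p t =>
    if i ≤ t then d (p t) (p (t + 1)) else d (p (t + 1)) (p t)
  have hinj : Set.InjOn code W := by
    rintro p ⟨him, hp, hpa, hpv⟩ q ⟨-, hq, hqa, hqv⟩ h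
    have hup : ∀ n, i + n ≤ m → p (i + n) = q (i + n) := by
      intro n
      induction n with
      | zero => intro _; simp [hp, hq]
      | succ n ih =>
        intro hn
        have hn' : i + n < m := by omega
        have h1 := congrFun h ⟨i + n, hn'⟩
        have e := ih hn'.le
        simp only [code, Nat.le_add_right, if_true] at h1
        rw [e] at h1
        exact hd _ _ _ (e ▸ hpa _ hn') (hqa _ hn') h1
    have hdown : ∀ n, n ≤ i → p (i - n) = q (i - n) := by
      intro n
      induction n with
      | zero => intro _; simp [hp, hq]
      | succ n ih =>
        intro hn
        have hn' : i - (n + 1) < m := by omega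
        have h1 := congrFun h ⟨i - (n + 1), hn'⟩
        have e := ih (by omega)
        have hs : i - n = i - (n + 1) + 1 := by omega
        rw [hs] at e
        have hlt : ¬ i ≤ i - (n + 1) := by omega
        simp only [code, hlt, if_false] at h1
        rw [e] at h1
        exact hd _ _ _ (e ▸ (hpa _ hn').symm) (hqa _ hn').symm h1
    funext t
    by_cases ht : m < t
    · rw [hpv t ht, hqv t ht]
    · by_cases hit : i ≤ t
      · have := hup (t - i) (by omega)
        rwa [show i + (t - i) = t by omega] at this
      · have := hdown (i - t) (by omega)
        rwa [show i - (i - t) = t by omega] at this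
  have hfin : W.Finite := Set.Finite.of_injOn (Set.mapsTo_univ code W) hinj Set.finite_univ
  refine ⟨hfin.toFinset, ?_, fun p h0 h1 h2 h3 => by simpa [W] using ⟨h0, h1, h2, h3⟩⟩
  have := card_le_card_of_injOn (s := hfin.toFinset) (t := univ) code (by simp)
    (by simpa using hinj)
  simpa using this

theorem pow_mul_card_listColorings_le {V : Type} [Fintype V] [DecidableEq V] (G : SimpleGraph V)
    (L : V → Finset ℕ) {β : ℝ} (hβ : 0 < β) {N : ℕ}
    (h : ∀ (S : Finset V) (v : V), v ∉ S → S.card < N →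
      β * ((listColorings G L S).card : ℝ) ≤ (listColorings G L (insert v S)).card)
    (A B : Finset V) (hAB : Disjoint A B) (hcard : (A ∪ B).card ≤ N) :
    β ^ B.card * ((listColorings G L A).card : ℝ) ≤ (listColorings G L (A ∪ B)).card := by
  induction B using Finset.induction_on with
  | empty => simp
  | insert b B hb ih =>
    rw [disjoint_insert_right] at hAB
    have hbn : b ∉ A ∪ B := by simp [hAB.1, hb]
    rw [union_insert, card_insert_of_notMem hbn] at hcard
    rw [union_insert, card_insert_of_notMem hb, pow_succ', mul_assoc]
    exact (mul_le_mul_of_nonneg_left (ih hAB.2 (by omega)) hβ.le).trans (h _ _ hbn (by omega))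

/-- Colorings of `insert v S` for which a path with `v` in its first half is repetitive are
determined by their values outside the first half. -/
theorem card_repetitive_le {V : Type} [Fintype V] [DecidableEq V] (G : SimpleGraph V)
    (L : V → Finset ℕ) (S H : Finset V) (v : V) (hvH : v ∈ H) (j : ℕ) (p : ℕ → V)
    (hH : ∀ u ∈ H, ∃ a < j, u = p a) (hpH : ∀ a < j, p (a + j) ∉ H) (E : Finset (V → ℕ))
    (hE : ∀ c ∈ E, (∀ u ∈ insert v S, c u ∈ L u) ∧ (∀ u, u ∉ insert v S → c u = 0) ∧
      NonrepetitiveOn G S c ∧ ∀ a < j, c (p a) = c (p (a + j))) :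
    E.card ≤ (listColorings G L (insert v S \ H)).card := by
  refine card_le_card_of_injOn (fun c u => if u ∈ H then 0 else c u) ?_ ?_
  · intro c hc
    obtain ⟨h1, h2, h3, -⟩ := hE c hc
    rw [mem_coe, mem_listColorings]
    refine ⟨fun u hu => ?_, fun u hu => ?_, h3.mono (fun u hu => ?_) fun u hu => ?_⟩
    · rw [mem_sdiff] at hu
      simpa [hu.2] using h1 u hu.1
    · by_cases huH : u ∈ H
      · simp [huH]
      · simpa [huH] using h2 u fun h => hu (mem_sdiff.2 ⟨h, huH⟩)
    · rw [mem_sdiff, mem_insert] at hu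
      rcases hu.1 with rfl | h
      · exact absurd hvH hu.2
      · exact h
    · simp [(mem_sdiff.1 hu).2]
  · intro c hc c' hc' h
    obtain ⟨-, -, -, h4⟩ := hE c hc
    obtain ⟨-, -, -, h4'⟩ := hE c' hc'
    have hout : ∀ u, u ∉ H → c u = c' u := fun u hu => by simpa [hu] using congrFun h u
    funext u
    by_cases hu : u ∈ H
    · obtain ⟨a, ha, rfl⟩ := hH u hu
      rw [h4 a ha, h4' a ha]
      exact hout _ (hpH a ha)
    · exact hout u hu

/-- A repetitively coloured path through `v` may be reversed so that `v` lies in its first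
half. -/
theorem exists_repetitive_path {V : Type} {G : SimpleGraph V} {S : Finset V} [DecidableEq V]
    {v : V} {c : V → ℕ} (hS : NonrepetitiveOn G S c) (hT : ¬ NonrepetitiveOn G (insert v S) c) :
    ∃ j : ℕ, 1 ≤ j ∧ ∃ p : ℕ → V,
      (∀ i, i + 1 < 2 * j → G.Adj (p i) (p (i + 1))) ∧
      (∀ i₁ i₂, i₁ < 2 * j → i₂ < 2 * j → i₁ ≠ i₂ → p i₁ ≠ p i₂) ∧
      (∀ i, i < 2 * j → p i ∈ insert v S) ∧
      (∀ i < j, c (p i) = c (p (i + j))) ∧ ∃ i < j, p i = v := by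
  unfold NonrepetitiveOn at hT
  push Not at hT
  obtain ⟨j, hj, p, hadj, hinj, hmem, hrep⟩ := hT
  have hv : ∃ i < 2 * j, p i = v := by
    by_contra! hno
    obtain ⟨i, hi, hne⟩ := hS j hj p hadj hinj fun i hi =>
      (mem_insert.1 (hmem i hi)).resolve_left (hno i hi)
    exact hne (hrep i hi)
  obtain ⟨i, hi, hiv⟩ := hv
  by_cases hij : i < j
  · exact ⟨j, hj, p, hadj, hinj, hmem, hrep, i, hij, hiv⟩
  · refine ⟨j, hj, fun t => p (2 * j - 1 - t), fun t ht => ?_, fun a b ha hb hab => ?_,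
      fun t ht => hmem _ (by omega), fun t ht => ?_, 2 * j - 1 - i, by omega, ?_⟩
    · have := hadj (2 * j - 1 - (t + 1)) (by omega)
      rw [show 2 * j - 1 - (t + 1) + 1 = 2 * j - 1 - t by omega] at this
      exact this.symm
    · exact hinj _ _ (by omega) (by omega) (by omega)
    · have := hrep (j - 1 - t) (by omega)
      rw [show j - 1 - t + j = 2 * j - 1 - t by omega] at this
      rw [← this]
      congr 2
      omega
    · simpa [show 2 * j - 1 - (2 * j - 1 - i) = i by omega] using hiv

theorem mul_card_listColorings_le {V : Type} [Fintype V] [DecidableEq V] (G : SimpleGraph V)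
    [DecidableRel G.Adj] {Δ k : ℕ} (hdeg : ∀ v, G.degree v ≤ Δ) (hΔ : 0 < Δ)
    (L : V → Finset ℕ) (hL : ∀ v, (L v).card = k) {β : ℝ} (hβ : 0 < β)
    (hk : ∀ n : ℕ, β + ∑ j ∈ range n, ((j : ℝ) + 1) * (Δ : ℝ) ^ (2 * j + 1) / β ^ j ≤ k)
    (N : ℕ) : ∀ (S : Finset V) (v : V), v ∉ S → S.card < N →
      β * ((listColorings G L S).card : ℝ) ≤ (listColorings G L (insert v S)).card := by
  induction N with
  | zero => intro S v _ h; omega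
  | succ N IH =>
  intro S v hv hSN
  set C : ℝ := ((listColorings G L S).card : ℝ) with hC
  let E : Finset (V → ℕ) :=
    (listColorings G L S ×ˢ L v).image fun x => Function.update x.1 v x.2
  have hEcard : E.card = (listColorings G L S).card * k := by
    rw [card_image_of_injOn, card_product, hL]
    rintro ⟨c, a⟩ hc ⟨c', a'⟩ hc' h
    simp only [coe_product, Set.mem_prod, mem_coe] at hc hc'
    have h0 := (mem_listColorings.1 hc.1).2.1 v hv
    have h0' := (mem_listColorings.1 hc'.1).2.1 v hv
    have ha : a = a' := by simpa using congrFun h v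
    have hcc : c = c' := by
      funext u
      by_cases hu : u = v
      · rw [hu, h0, h0']
      · simpa [hu] using congrFun h u
    rw [ha, hcc]
  have hE : ∀ c ∈ E, (∀ u ∈ insert v S, c u ∈ L u) ∧ (∀ u, u ∉ insert v S → c u = 0) ∧
      NonrepetitiveOn G S c := by
    intro c hc
    obtain ⟨⟨c, a⟩, hx, rfl⟩ := mem_image.1 hc
    obtain ⟨hcS, ha⟩ := mem_product.1 hx
    obtain ⟨h1, h2, h3⟩ := mem_listColorings.1 hcS
    refine ⟨fun u hu => ?_, fun u hu => ?_, h3.mono Subset.rfl fun u hu => ?_⟩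
    · by_cases huv : u = v
      · subst huv; simpa using ha
      · simpa [huv] using h1 u ((mem_insert.1 hu).resolve_left huv)
    · rw [mem_insert, not_or] at hu
      simpa [hu.1] using h2 u hu.2
    · have : u ≠ v := fun h => hv (h ▸ hu)
      simp [this]
  choose F hFcard hF using fun j i => exists_finset_walks G hdeg hΔ (2 * j + 1) i v
  let isPath : ℕ → ℕ → (ℕ → V) → Prop := fun j i p =>
    (∀ i₁ i₂, i₁ < 2 * (j + 1) → i₂ < 2 * (j + 1) → i₁ ≠ i₂ → p i₁ ≠ p i₂) ∧
    (∀ a < 2 * (j + 1), p a ∈ insert v S) ∧ p i = v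
  classical
  let bad : ℕ → (ℕ → V) → Finset (V → ℕ) := fun j p =>
    E.filter fun c => ∀ a < j + 1, c (p a) = c (p (a + (j + 1)))
  let n := Fintype.card V
  let Bad : Finset (V → ℕ) := (range n).biUnion fun j => (range (j + 1)).biUnion fun i =>
    ((F j i).filter (isPath j i)).biUnion fun p => bad j p
  have hsub : E ⊆ listColorings G L (insert v S) ∪ Bad := by
    intro c hc
    obtain ⟨h1, h2, h3⟩ := hE c hc
    by_cases hT : NonrepetitiveOn G (insert v S) c
    · exact mem_union_left _ (mem_listColorings.2 ⟨h1, h2, hT⟩)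
    refine mem_union_right _ ?_
    obtain ⟨j, hj, p, hadj, hinj, hmem, hrep, i, hi, hiv⟩ := exists_repetitive_path h3 hT
    obtain ⟨j, rfl⟩ : ∃ j', j = j' + 1 := ⟨j - 1, by omega⟩
    have hjn : j < n := by
      have : (range (2 * (j + 1))).card ≤ (univ : Finset V).card :=
        card_le_card_of_injOn p (by simp) fun a ha b hb hab => by
          by_contra hne
          exact hinj a b (by simpa using ha) (by simpa using hb) hne hab
      rw [card_range, card_univ] at this
      omega
    let q : ℕ → V := fun t => if t < 2 * (j + 1) then p t else v
    have hq : ∀ t, t < 2 * (j + 1) → q t = p t := fun t ht => by simp [q, ht]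
    simp only [Bad, mem_biUnion, mem_range, mem_filter]
    refine ⟨j, hjn, i, hi, q, ⟨hF j i q (by omega) ?_ ?_ ?_, ?_, ?_, ?_⟩, ?_⟩
    · rw [hq i (by omega), hiv]
    · intro t ht
      rw [hq t (by omega), hq (t + 1) (by omega)]
      exact hadj t (by omega)
    · intro t ht
      simp [q, show ¬ t < 2 * (j + 1) by omega]
    · intro a b ha hb
      rw [hq a ha, hq b hb]
      exact hinj a b ha hb
    · intro a ha
      rw [hq a ha]
      exact hmem a ha
    · rw [hq i (by omega), hiv]
    · simp only [bad, mem_filter]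
      refine ⟨hc, fun a ha => ?_⟩
      rw [hq a (by omega), hq _ (by omega)]
      exact hrep a ha
  have hbad : ∀ j i p, i < j + 1 → isPath j i p → ((bad j p).card : ℝ) ≤ C / β ^ j := by
    rintro j i p hi ⟨hinj, hmem, hiv⟩
    let H : Finset V := (range (j + 1)).image p
    have hHc : H.card = j + 1 := by
      rw [card_image_of_injOn, card_range]
      intro a ha b hb hab
      by_contra hne
      simp only [coe_range, Set.mem_Iio] at ha hb
      exact hinj a b (by omega) (by omega) hne hab
    have hvH : v ∈ H := mem_image.2 ⟨i, mem_range.2 hi, hiv⟩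
    have hHT : H ⊆ insert v S := by
      intro u hu
      obtain ⟨a, ha, rfl⟩ := mem_image.1 hu
      exact hmem a (by rw [mem_range] at ha; omega)
    have h1 : (bad j p).card ≤ (listColorings G L (insert v S \ H)).card := by
      refine card_repetitive_le G L S H v hvH (j + 1) p ?_ ?_ _ ?_
      · intro u hu
        obtain ⟨a, ha, rfl⟩ := mem_image.1 hu
        exact ⟨a, mem_range.1 ha, rfl⟩
      · intro a ha hmemH
        obtain ⟨b, hb, hab⟩ := mem_image.1 hmemH
        rw [mem_range] at hb
        exact hinj b (a + (j + 1)) (by omega) (by omega) (by omega) hab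
      · intro c hc
        obtain ⟨hcE, hrep⟩ := mem_filter.1 hc
        obtain ⟨a1, a2, a3⟩ := hE c hcE
        exact ⟨a1, a2, a3, hrep⟩
    have hunion : (insert v S \ H) ∪ (H.erase v) = S := by
      ext u
      have := @hHT u
      by_cases huv : u = v
      · subst huv; simp [hv, hvH]
      · simp only [mem_insert, huv, false_or] at this
        simp only [mem_union, mem_sdiff, mem_insert, mem_erase, huv]
        tauto
    have h2 := pow_mul_card_listColorings_le G L hβ IH (insert v S \ H) (H.erase v)
      (disjoint_sdiff_self_left.mono_right (erase_subset _ _)) (by rw [hunion]; omega)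
    rw [hunion, card_erase_of_mem hvH, hHc, Nat.add_sub_cancel] at h2
    rw [le_div_iff₀ (pow_pos hβ j), mul_comm]
    refine le_trans ?_ h2
    gcongr
  have hC0 : 0 ≤ C := Nat.cast_nonneg _
  have hBad : (Bad.card : ℝ) ≤
      ∑ j ∈ range n, (((j : ℝ) + 1) * (Δ : ℝ) ^ (2 * j + 1) / β ^ j) * C := by
    refine (Nat.cast_le.2 card_biUnion_le).trans ?_
    rw [Nat.cast_sum]
    refine sum_le_sum fun j _ => ?_
    refine (Nat.cast_le.2 card_biUnion_le).trans ?_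
    rw [Nat.cast_sum]
    have : ∀ i ∈ range (j + 1), ((((F j i).filter (isPath j i)).biUnion fun p => bad j p).card : ℝ)
        ≤ (Δ : ℝ) ^ (2 * j + 1) * (C / β ^ j) := by
      intro i hi
      refine (Nat.cast_le.2 card_biUnion_le).trans ?_
      rw [Nat.cast_sum]
      refine (sum_le_card_nsmul _ _ (C / β ^ j) fun p hp => ?_).trans ?_
      · exact hbad j i p (mem_range.1 hi) (mem_filter.1 hp).2
      · rw [nsmul_eq_mul]
        gcongr
        exact_mod_cast (card_filter_le _ _).trans (hFcard j i)
    refine (sum_le_card_nsmul _ _ _ this).trans (le_of_eq ?_)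
    rw [card_range, nsmul_eq_mul]
    push_cast
    ring
  have hmain : C * k ≤ (listColorings G L (insert v S)).card + Bad.card := by
    have := (card_le_card hsub).trans (card_union_le _ _)
    rw [hEcard] at this
    rw [hC]
    exact_mod_cast this
  rw [← sum_mul] at hBad
  have := mul_le_mul_of_nonneg_right (hk n) hC0
  linarith

theorem sum_succ_mul_pow_le {r : ℝ} (h0 : 0 ≤ r) (h1 : r < 1) (n : ℕ) :
    ∑ j ∈ range n, ((j : ℝ) + 1) * r ^ j ≤ 1 / (1 - r) ^ 2 := by
  have hid : (∑ j ∈ range n, ((j : ℝ) + 1) * r ^ j) * (1 - r) ^ 2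
      = 1 - (n + 1) * r ^ n + n * r ^ (n + 1) := by
    induction n with
    | zero => simp
    | succ n ih =>
      rw [sum_range_succ, add_mul, ih]
      push_cast
      ring
  rw [le_div_iff₀ (pow_pos (sub_pos.2 h1) 2), hid]
  have hr : 0 ≤ r ^ n := pow_nonneg h0 n
  have : (n : ℝ) * r ^ (n + 1) ≤ n * r ^ n := by
    rw [pow_succ]
    exact mul_le_mul_of_nonneg_left (mul_le_of_le_one_right hr h1.le) (Nat.cast_nonneg n)
  linarith

/-- The choice `β = t ^ 6 + s * t ^ 5`, where `s ^ 3 = 2` and `t ^ 3 = Δ`. -/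
theorem add_sum_le_of_cube {s t : ℝ} (hs : 0 < s) (hst : s < t) (hs3 : s ^ 3 = 2) (n : ℕ) :
    (t ^ 6 + s * t ^ 5) +
      ∑ j ∈ range n, ((j : ℝ) + 1) * (t ^ 3) ^ (2 * j + 1) / (t ^ 6 + s * t ^ 5) ^ j
    ≤ (t ^ 3) ^ 2 + 3 / s ^ 2 * t ^ 5 + s ^ 2 * t ^ 5 / (t - s) := by
  have ht : 0 < t := hs.trans hst
  have hterm : ∀ j ∈ range n, ((j : ℝ) + 1) * (t ^ 3) ^ (2 * j + 1) / (t ^ 6 + s * t ^ 5) ^ j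
      = t ^ 3 * (((j : ℝ) + 1) * (t / (t + s)) ^ j) := by
    intro j _
    have e1 : t / (t + s) = t ^ 6 / (t ^ 6 + s * t ^ 5) := by
      field_simp
    rw [e1, div_pow]
    ring
  rw [sum_congr rfl hterm, ← mul_sum]
  have hsum := sum_succ_mul_pow_le (r := t / (t + s)) (by positivity)
    ((div_lt_one (by positivity)).2 (by linarith)) n
  have hr : 1 / (1 - t / (t + s)) ^ 2 = (t + s) ^ 2 / s ^ 2 := by
    rw [one_sub_div (by positivity), add_sub_cancel_left, div_pow, one_div_div]
  rw [hr] at hsum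
  have h1 := mul_le_mul_of_nonneg_left hsum (pow_pos ht 3).le
  have h2 : t ^ 3 * ((t + s) ^ 2 / s ^ 2) = t ^ 5 / s ^ 2 + s ^ 2 * t ^ 4 + t ^ 3 := by
    field_simp
    linear_combination (-s*t) * hs3
  have h3 : s ^ 2 * t ^ 4 + t ^ 3 ≤ s ^ 2 * t ^ 5 / (t - s) := by
    rw [le_div_iff₀ (sub_pos.2 hst)]
    have : 0 ≤ t ^ 4 + s * t ^ 3 := by positivity
    have : (s ^ 2 * t ^ 4 + t ^ 3) * (t - s) = s ^ 2 * t ^ 5 - (t ^ 4 + s * t ^ 3) := by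
      linear_combination (-t ^ 4) * hs3
    linarith
  have h4 : 3 / s ^ 2 * t ^ 5 = s * t ^ 5 + t ^ 5 / s ^ 2 := by
    field_simp
    linear_combination (-1) * hs3
  rw [h4]
  have : (t ^ 3) ^ 2 = t ^ 6 := by ring
  linarith

theorem stmt5 {V : Type} [Fintype V] (G : SimpleGraph V) [DecidableRel G.Adj]
    (Δ : ℕ) (hΔ : G.maxDegree = Δ) (h3 : 3 ≤ Δ) :
    nonrepetitiveChoiceNumber G ≤
      ⌈(Δ : ℝ) ^ 2 + (3 / (2 : ℝ) ^ ((2 : ℝ) / 3)) * (Δ : ℝ) ^ ((5 : ℝ) / 3)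
        + (2 : ℝ) ^ ((2 : ℝ) / 3) * (Δ : ℝ) ^ ((5 : ℝ) / 3)
          / ((Δ : ℝ) ^ ((1 : ℝ) / 3) - (2 : ℝ) ^ ((1 : ℝ) / 3))⌉₊ := by
  classical
  set s : ℝ := (2 : ℝ) ^ ((1 : ℝ) / 3) with hs
  set t : ℝ := (Δ : ℝ) ^ ((1 : ℝ) / 3) with ht
  have hs0 : 0 < s := by positivity
  have h2Δ : (2 : ℝ) < Δ := by exact_mod_cast h3
  have hst : s < t := Real.rpow_lt_rpow (by norm_num) h2Δ (by norm_num)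
  have hrpow : ∀ x : ℝ, 0 ≤ x → ∀ m : ℕ, x ^ ((m : ℝ) / 3) = (x ^ ((1 : ℝ) / 3)) ^ m := by
    intro x hx m
    rw [← Real.rpow_natCast, ← Real.rpow_mul hx]
    congr 1
    ring
  have hs3 : s ^ 3 = 2 := by
    rw [hs, ← hrpow 2 (by norm_num) 3]
    norm_num
  have ht3 : t ^ 3 = Δ := by
    rw [ht, ← hrpow Δ (by positivity) 3]
    norm_num
  have e2 : (2 : ℝ) ^ ((2 : ℝ) / 3) = s ^ 2 := by
    exact_mod_cast hrpow 2 (by norm_num) 2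
  have e5 : (Δ : ℝ) ^ ((5 : ℝ) / 3) = t ^ 5 := by
    exact_mod_cast hrpow Δ (by positivity) 5
  rw [e2, e5]
  set k := ⌈(Δ : ℝ) ^ 2 + 3 / s ^ 2 * t ^ 5 + s ^ 2 * t ^ 5 / (t - s)⌉₊ with hk
  have ht0 : 0 < t := hs0.trans hst
  have hβ : 0 < t ^ 6 + s * t ^ 5 := by positivity
  refine Nat.sInf_le fun L hL => ?_
  have hstep := mul_card_listColorings_le G (Δ := Δ) (k := k)
    (fun v => hΔ ▸ G.degree_le_maxDegree v) (by omega) L hL hβ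
    (fun n => by
      have := add_sum_le_of_cube hs0 hst hs3 n
      rw [ht3] at this
      exact this.trans (Nat.le_ceil _)) (Fintype.card V)
  have hpow := pow_mul_card_listColorings_le G L hβ hstep ∅ univ (disjoint_empty_left _)
    (card_le_univ _)
  have hempty : (fun _ => 0) ∈ listColorings G L ∅ := by
    refine mem_listColorings.2 ⟨by simp, by simp, fun j hj p _ _ hmem => ?_⟩
    exact absurd (hmem 0 (by omega)) (notMem_empty _)
  have hpos : (0 : ℝ) < (listColorings G L ∅).card := by
    exact_mod_cast card_pos.2 ⟨_, hempty⟩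
  have hcard : (0 : ℝ) < (listColorings G L (∅ ∪ univ)).card :=
    (mul_pos (pow_pos hβ _) hpos).trans_le hpow
  obtain ⟨c, hc⟩ := card_pos.1 (Nat.cast_pos.1 hcard)
  obtain ⟨h1, -, h2⟩ := mem_listColorings.1 hc
  exact ⟨c, fun v => h1 v (by simp), fun j hj p hadj hinj => h2 j hj p hadj hinj (by simp)⟩
end

section
/- There exists a constant c > 0 such that every graph G with maximum degree Δ ≥ 3 satisfies π'_l(G) ≤ Δ² + 2^(4/3)·Δ^(5/3) + c·Δ^(4/3), where π'_l(G) is the Thue choice index of G. -/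
/-- An edge coloring is nonrepetitive if for every path `e_1, …, e_{2j}` on `2j` edges
(`j ≥ 1`) in `G`, the sequence of colors of the first half differs from that of the
second half. A path on `2j` edges is given by `2j + 1` distinct vertices
`p 0, p 1, …, p (2j)` with consecutive vertices adjacent. -/
def IsNonrepetitiveEdgeColoring {V : Type} (G : SimpleGraph V) (c : Sym2 V → ℕ) : Prop :=
  ∀ j : ℕ, 1 ≤ j → ∀ p : ℕ → V,
    (∀ i, i < 2 * j → G.Adj (p i) (p (i + 1))) →
    (∀ i₁ i₂, i₁ ≤ 2 * j → i₂ ≤ 2 * j → i₁ ≠ i₂ → p i₁ ≠ p i₂) →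
    ∃ i < j, c s(p i, p (i + 1)) ≠ c s(p (i + j), p (i + j + 1))

/-- The Thue choice index: the least `k` such that for every assignment of lists of
size `k` to the edges there is a nonrepetitive edge coloring from the lists. -/
noncomputable def thueChoiceIndex {V : Type} (G : SimpleGraph V) : ℕ :=
  sInf {k | ∀ L : Sym2 V → Finset ℕ, (∀ e ∈ G.edgeSet, (L e).card = k) →
    ∃ c : Sym2 V → ℕ, (∀ e ∈ G.edgeSet, c e ∈ L e) ∧ IsNonrepetitiveEdgeColoring G c}

namespace ThueChoice

open Finset

section Counting

variable {E : Type*}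

/-- The coloring `f` is free of repetitions along the words of `W` all of whose letters lie in `S`.
A word of `W j` is given by its two halves, each of length `j + 1`. -/
def IsFree (W : ∀ j, Finset ((Fin (j + 1) → E) × (Fin (j + 1) → E))) (S : Finset E)
    (f : E → ℕ) : Prop :=
  ∀ j, ∀ w ∈ W j, (∀ i, w.1 i ∈ S) → (∀ i, w.2 i ∈ S) → ∃ i, f (w.1 i) ≠ f (w.2 i)

lemma IsFree.congr {W : ∀ j, Finset ((Fin (j + 1) → E) × (Fin (j + 1) → E))} {S : Finset E}
    {f g : E → ℕ} (hf : IsFree W S f) (h : ∀ x ∈ S, f x = g x) : IsFree W S g := by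
  intro j w hw h1 h2
  obtain ⟨i, hi⟩ := hf j w hw h1 h2
  exact ⟨i, by rwa [← h _ (h1 i), ← h _ (h2 i)]⟩

lemma IsFree.mono {W : ∀ j, Finset ((Fin (j + 1) → E) × (Fin (j + 1) → E))} {S T : Finset E}
    {f : E → ℕ} (hf : IsFree W S f) (h : T ⊆ S) : IsFree W T f :=
  fun j w hw h1 h2 => hf j w hw (fun i => h (h1 i)) (fun i => h (h2 i))

variable [Fintype E] [DecidableEq E]

/-- The colorings of `S` from the lists `L`, extended by `0` outside `S`. -/
def listColorings (L : E → Finset ℕ) (S : Finset E) : Finset (E → ℕ) :=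
  Fintype.piFinset fun e => if e ∈ S then L e else {0}

lemma mem_listColorings {L : E → Finset ℕ} {S : Finset E} {f : E → ℕ} :
    f ∈ listColorings L S ↔ (∀ e ∈ S, f e ∈ L e) ∧ ∀ e ∉ S, f e = 0 := by
  simp only [listColorings, Fintype.mem_piFinset]
  constructor
  · intro h
    exact ⟨fun e he => by simpa [he] using h e, fun e he => by simpa [he] using h e⟩
  · rintro ⟨h1, h2⟩ e
    by_cases he : e ∈ S
    · simpa [he] using h1 e he
    · simpa [he] using h2 e he

open Classical in
/-- The repetition-free colorings of `S` from the lists `L`. -/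
noncomputable def freeColorings (W : ∀ j, Finset ((Fin (j + 1) → E) × (Fin (j + 1) → E)))
    (L : E → Finset ℕ) (S : Finset E) : Finset (E → ℕ) :=
  {f ∈ listColorings L S | IsFree W S f}

variable {W : ∀ j, Finset ((Fin (j + 1) → E) × (Fin (j + 1) → E))} {L : E → Finset ℕ}

lemma mem_freeColorings {S : Finset E} {f : E → ℕ} :
    f ∈ freeColorings W L S ↔
      ((∀ e ∈ S, f e ∈ L e) ∧ ∀ e ∉ S, f e = 0) ∧ IsFree W S f := by
  simp [freeColorings, mem_listColorings]

open Classical in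
/-- Every repetition-free coloring of `S` extends to `e` in `#(L e)` ways. -/
lemma card_freeColorings_mul_le {S : Finset E} {e : E} (he : e ∉ S) :
    #(freeColorings W L S) * #(L e) ≤ #{f ∈ listColorings L (insert e S) | IsFree W S f} := by
  rw [← card_product]
  refine card_le_card_of_injOn (fun q => Function.update q.1 e q.2) ?_ ?_
  · rintro ⟨g, c⟩ hq
    simp only [coe_product, Set.mem_prod, mem_coe, mem_freeColorings] at hq
    obtain ⟨⟨⟨h1, h2⟩, h3⟩, hc⟩ := hq
    simp only [coe_filter, Set.mem_ofPred_eq, mem_listColorings]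
    refine ⟨⟨?_, ?_⟩, h3.congr ?_⟩
    · intro x hx
      by_cases hxe : x = e
      · subst hxe; simpa using hc
      · simpa [hxe] using h1 x ((mem_insert.1 hx).resolve_left hxe)
    · intro x hx
      rw [mem_insert, not_or] at hx
      simpa [hx.1] using h2 x hx.2
    · intro x hx
      have : x ≠ e := fun h => he (h ▸ hx)
      simp [this]
  · rintro ⟨g, c⟩ hq ⟨g', c'⟩ hq' h
    simp only [coe_product, Set.mem_prod, mem_coe, mem_freeColorings] at hq hq'
    simp only at h
    have hc : c = c' := by simpa using congrFun h e
    refine Prod.ext (funext fun x => ?_) hc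
    by_cases hxe : x = e
    · subst hxe
      exact (hq.1.1.2 x he).trans (hq'.1.1.2 x he).symm
    · simpa [hxe] using congrFun h x

open Classical in
/-- A coloring repetitive along `w` is determined by its values off the first half of `w`. -/
lemma card_repetitive_le {S : Finset E} {e : E} {j : ℕ}
    {w : (Fin (j + 1) → E) × (Fin (j + 1) → E)} (hdisj : ∀ i i', w.1 i ≠ w.2 i')
    (hew : ∃ i, w.1 i = e) :
    #{f ∈ listColorings L (insert e S) | IsFree W S f ∧ (∀ i, w.2 i ∈ insert e S) ∧
        ∀ i, f (w.1 i) = f (w.2 i)} ≤ #(freeColorings W L (S \ univ.image w.1)) := by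
  refine card_le_card_of_injOn (fun f x => if x ∈ S \ univ.image w.1 then f x else 0) ?_ ?_
  · intro f hf
    simp only [coe_filter, Set.mem_ofPred_eq, mem_listColorings] at hf
    obtain ⟨⟨h1, h2⟩, h3, h4, h5⟩ := hf
    rw [mem_coe, mem_freeColorings]
    refine ⟨⟨fun x hx => ?_, fun x hx => if_neg hx⟩, (h3.mono sdiff_subset).congr ?_⟩
    · simp only [if_pos hx]
      exact h1 x (mem_insert_of_mem (sdiff_subset hx))
    · intro x hx
      simp only [if_pos hx]
  · intro f hf g hg h
    simp only [coe_filter, Set.mem_ofPred_eq, mem_listColorings] at hf hg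
    obtain ⟨⟨-, hf2⟩, -, hf4, hf5⟩ := hf
    obtain ⟨⟨-, hg2⟩, -, -, hg5⟩ := hg
    have key : ∀ x ∈ S \ univ.image w.1, f x = g x := by
      intro x hx
      simpa only [if_pos hx] using congrFun h x
    have hfirst : ∀ i, f (w.1 i) = g (w.1 i) := by
      intro i
      rw [hf5, hg5]
      apply key
      have hni : w.2 i ∉ univ.image w.1 := by
        simpa using fun i' => hdisj i' i
      refine mem_sdiff.2 ⟨(mem_insert.1 (hf4 i)).resolve_left ?_, hni⟩
      obtain ⟨i', hi'⟩ := hew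
      exact fun h => hdisj i' i (hi'.trans h.symm)
    funext x
    by_cases hx : x ∈ univ.image w.1
    · obtain ⟨i, -, rfl⟩ := mem_image.1 hx
      exact hfirst i
    by_cases hxS : x ∈ S
    · exact key x (mem_sdiff.2 ⟨hxS, hx⟩)
    have hxe : x ≠ e := by
      rintro rfl
      obtain ⟨i, hi⟩ := hew
      exact hx (mem_image.2 ⟨i, mem_univ _, hi⟩)
    have : x ∉ insert e S := by simp [hxe, hxS]
    rw [hf2 x this, hg2 x this]

/-- If each new element multiplies the number of repetition-free colorings by at least `β`, then
`D` new elements multiply it by at least `β ^ #D`. -/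
lemma pow_mul_card_freeColorings_le {β : ℝ} (hβ : 0 ≤ β) {S : Finset E}
    (ih : ∀ T, #T < #S → ∀ e ∉ T,
      β * #(freeColorings W L T) ≤ #(freeColorings W L (insert e T)))
    {T : Finset E} (hT : T ⊆ S) :
    β ^ #(S \ T) * #(freeColorings W L T) ≤ #(freeColorings W L S) := by
  suffices H : ∀ D : Finset E, Disjoint T D → T ∪ D ⊆ S →
      β ^ #D * #(freeColorings W L T) ≤ #(freeColorings W L (T ∪ D)) by
    have := H (S \ T) disjoint_sdiff (by rw [union_sdiff_of_subset hT])
    rwa [union_sdiff_of_subset hT] at this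
  intro D
  induction D using Finset.induction_on with
  | empty => simp
  | insert x D hx IH =>
    intro hd hs
    rw [disjoint_insert_right] at hd
    rw [union_insert] at hs ⊢
    have hx' : x ∉ T ∪ D := by simp [hx, hd.1]
    have h1 := IH hd.2 ((subset_insert _ _).trans hs)
    have hlt : #(T ∪ D) < #S :=
      lt_of_lt_of_le (by rw [card_insert_of_notMem hx']; omega) (card_le_card hs)
    have h2 := ih _ hlt x hx'
    rw [card_insert_of_notMem hx, pow_succ']
    calc _ = β * (β ^ #D * #(freeColorings W L T)) := by ring
      _ ≤ β * #(freeColorings W L (T ∪ D)) := by gcongr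
      _ ≤ _ := h2

open Classical in
/-- Adding an element multiplies the number of repetition-free colorings by at least `β`. -/
lemma mul_card_freeColorings_le {β : ℝ} (hβ : 0 < β) {k : ℕ} (hL : ∀ e, #(L e) = k)
    (hinj : ∀ j, ∀ w ∈ W j, Function.Injective w.1)
    (hdisj : ∀ j, ∀ w ∈ W j, ∀ i i', w.1 i ≠ w.2 i')
    (hrev : ∀ j, ∀ w ∈ W j, (w.2 ∘ Fin.rev, w.1 ∘ Fin.rev) ∈ W j)
    {N : ℕ → ℝ} (hN : ∀ j e, (#{w ∈ W j | ∃ i, w.1 i = e} : ℝ) ≤ N j)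
    (hk : β + ∑ j ∈ range (Fintype.card E), N j / β ^ j ≤ k)
    (S : Finset E) (e : E) (he : e ∉ S) :
    β * #(freeColorings W L S) ≤ #(freeColorings W L (insert e S)) := by
  induction hn : #S using Nat.strong_induction_on generalizing S e with
  | _ n IH =>
  subst hn
  have ih : ∀ T, #T < #S → ∀ e ∉ T,
      β * #(freeColorings W L T) ≤ #(freeColorings W L (insert e T)) :=
    fun T hT e he => IH _ hT T e he rfl
  set bad : (j : ℕ) → (Fin (j + 1) → E) × (Fin (j + 1) → E) → Finset (E → ℕ) := fun j w =>
    {f ∈ listColorings L (insert e S) | IsFree W S f ∧ (∀ i, w.1 i ∈ insert e S) ∧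
      (∀ i, w.2 i ∈ insert e S) ∧ ∀ i, f (w.1 i) = f (w.2 i)} with hbad
  have hcover : {f ∈ listColorings L (insert e S) | IsFree W S f} ⊆
      freeColorings W L (insert e S) ∪
        (range (Fintype.card E)).biUnion fun j =>
          {w ∈ W j | ∃ i, w.1 i = e}.biUnion (bad j) := by
    intro f hf
    rw [mem_filter] at hf
    rw [mem_union]
    by_cases hfree : IsFree W (insert e S) f
    · left
      exact mem_filter.2 ⟨hf.1, hfree⟩
    right
    simp only [IsFree, not_forall, not_exists, not_not] at hfree
    obtain ⟨j, w, hw, h1, h2, heq⟩ := hfree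
    have hj : j ∈ range (Fintype.card E) := by
      have := Fintype.card_le_of_injective _ (hinj j w hw)
      rw [Fintype.card_fin] at this
      exact mem_range.2 this
    by_cases hfst : ∃ i, w.1 i = e
    · simp only [mem_biUnion]
      exact ⟨j, hj, w, mem_filter.2 ⟨hw, hfst⟩, mem_filter.2 ⟨hf.1, hf.2, h1, h2, heq⟩⟩
    by_cases hsnd : ∃ i, w.2 i = e
    · simp only [mem_biUnion]
      obtain ⟨i, hi⟩ := hsnd
      refine ⟨j, hj, _, mem_filter.2 ⟨hrev j w hw, i.rev, by simpa using hi⟩,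
        mem_filter.2 ⟨hf.1, hf.2, fun i => h2 _, fun i => h1 _, fun i => (heq _).symm⟩⟩
    exfalso
    rw [not_exists] at hfst hsnd
    obtain ⟨i, hi⟩ := hf.2 j w hw (fun i => (mem_insert.1 (h1 i)).resolve_left (hfst i))
      (fun i => (mem_insert.1 (h2 i)).resolve_left (hsnd i))
    exact hi (heq i)
  have hbadcard : ∀ j, ∀ w ∈ W j, (∃ i, w.1 i = e) →
      (#(bad j w) : ℝ) ≤ #(freeColorings W L S) / β ^ j := by
    intro j w hw hew
    by_cases hmem : ∀ i, w.1 i ∈ insert e S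
    · have hle : #(bad j w) ≤ #(freeColorings W L (S \ univ.image w.1)) := by
        refine le_trans (card_le_card ?_) (card_repetitive_le (hdisj j w hw) hew)
        intro f hf
        simp only [hbad, mem_filter] at hf ⊢
        exact ⟨hf.1, hf.2.1, hf.2.2.2⟩
      have hcard : #(S \ (S \ univ.image w.1)) = j := by
        have : S \ (S \ univ.image w.1) = (univ.image w.1).erase e := by
          ext x
          simp only [mem_sdiff, mem_erase, mem_image, mem_univ, true_and, not_and, not_not]
          constructor
          · rintro ⟨hx, hx'⟩
            exact ⟨fun h => he (h ▸ hx), hx' hx⟩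
          · rintro ⟨hx, i, rfl⟩
            exact ⟨(mem_insert.1 (hmem i)).resolve_left hx, fun _ => ⟨i, rfl⟩⟩
        rw [this, card_erase_of_mem (by simpa using hew),
          card_image_of_injective _ (hinj j w hw)]
        simp
      have hpow := pow_mul_card_freeColorings_le hβ.le ih
        (sdiff_subset : S \ univ.image w.1 ⊆ S)
      rw [hcard] at hpow
      rw [le_div_iff₀ (by positivity)]
      calc (#(bad j w) : ℝ) * β ^ j
          ≤ #(freeColorings W L (S \ univ.image w.1)) * β ^ j := by gcongr
        _ ≤ _ := by rwa [mul_comm]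
    · have : bad j w = ∅ := by
        simp only [hbad, filter_eq_empty_iff]
        exact fun f _ h => hmem h.2.1
      rw [this]
      simp only [card_empty, Nat.cast_zero]
      positivity
  have htotal : (#((range (Fintype.card E)).biUnion fun j =>
      {w ∈ W j | ∃ i, w.1 i = e}.biUnion (bad j)) : ℝ) ≤
      (∑ j ∈ range (Fintype.card E), N j / β ^ j) * #(freeColorings W L S) := by
    calc _ ≤ ((∑ j ∈ range (Fintype.card E), ∑ w ∈ W j with ∃ i, w.1 i = e,
              #(bad j w) : ℕ) : ℝ) := by
            exact_mod_cast card_biUnion_le.trans (sum_le_sum fun j _ => card_biUnion_le)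
      _ ≤ ∑ j ∈ range (Fintype.card E), N j * (#(freeColorings W L S) / β ^ j) := by
            push_cast
            refine sum_le_sum fun j _ => ?_
            refine (sum_le_card_nsmul _ _ (#(freeColorings W L S) / β ^ j) ?_).trans ?_
            · intro w hw
              rw [mem_filter] at hw
              exact hbadcard j w hw.1 hw.2
            · rw [nsmul_eq_mul]
              gcongr
              exact hN j e
      _ = _ := by
            rw [sum_mul]
            exact sum_congr rfl fun j _ => by ring
  have h1 := (card_freeColorings_mul_le (W := W) (L := L) he).trans
    ((card_le_card hcover).trans (card_union_le _ _))
  rw [hL] at h1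
  have h2 : (#(freeColorings W L S) : ℝ) * k ≤ #(freeColorings W L (insert e S)) +
      #((range (Fintype.card E)).biUnion fun j =>
        {w ∈ W j | ∃ i, w.1 i = e}.biUnion (bad j)) := by exact_mod_cast h1
  have h3 := mul_le_mul_of_nonneg_right hk (Nat.cast_nonneg (α := ℝ) #(freeColorings W L S))
  linarith

open Classical in
/-- If the lists are long compared with the number of words through each element, then there is a
repetition-free coloring from the lists. -/
lemma exists_free_coloring {β : ℝ} (hβ : 0 < β) {k : ℕ} (hL : ∀ e, #(L e) = k)
    (hinj : ∀ j, ∀ w ∈ W j, Function.Injective w.1)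
    (hdisj : ∀ j, ∀ w ∈ W j, ∀ i i', w.1 i ≠ w.2 i')
    (hrev : ∀ j, ∀ w ∈ W j, (w.2 ∘ Fin.rev, w.1 ∘ Fin.rev) ∈ W j)
    {N : ℕ → ℝ} (hN : ∀ j e, (#{w ∈ W j | ∃ i, w.1 i = e} : ℝ) ≤ N j)
    (hk : β + ∑ j ∈ range (Fintype.card E), N j / β ^ j ≤ k) :
    ∃ f : E → ℕ, (∀ e, f e ∈ L e) ∧ ∀ j, ∀ w ∈ W j, ∃ i, f (w.1 i) ≠ f (w.2 i) := by
  have hstep := mul_card_freeColorings_le hβ hL hinj hdisj hrev hN hk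
  have hpow := pow_mul_card_freeColorings_le (W := W) (L := L) hβ.le (S := univ)
    (fun T _ e he => hstep T e he) (empty_subset _)
  have hempty : (fun _ => 0) ∈ freeColorings W L ∅ := by
    rw [mem_freeColorings]
    refine ⟨⟨by simp, by simp⟩, fun j w _ h1 _ => ?_⟩
    simpa using h1 0
  have hpos : (0 : ℝ) < #(freeColorings W L ∅) := by
    exact_mod_cast card_pos.2 ⟨_, hempty⟩
  have hpos' : (0 : ℝ) < #(freeColorings W L (univ : Finset E)) :=
    lt_of_lt_of_le (by positivity) hpow
  obtain ⟨f, hf⟩ := card_pos.1 (Nat.cast_pos.1 hpos')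
  rw [mem_freeColorings] at hf
  exact ⟨f, fun e => hf.1.1 e (mem_univ e),
    fun j w hw => hf.2 j w hw (fun _ => mem_univ _) (fun _ => mem_univ _)⟩

end Counting

section Paths

lemma edge_injective_of_injective {V : Type*} {n : ℕ} {p : Fin (n + 1) → V} (hp : Function.Injective p)
    {a b : ℕ} (ha : a + 1 < n + 1) (hb : b + 1 < n + 1)
    (h : s(p ⟨a, by omega⟩, p ⟨a + 1, ha⟩) = s(p ⟨b, by omega⟩, p ⟨b + 1, hb⟩)) : a = b := by
  rw [Sym2.eq_iff] at h
  rcases h with ⟨h, -⟩ | ⟨h, h'⟩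
  · simpa using hp h
  · have h := hp h
    have h' := hp h'
    simp only [Fin.mk.injEq] at h h'
    omega

variable {V : Type*} [Fintype V] (G : SimpleGraph V) [DecidableRel G.Adj]

/-- The neighbors of each vertex can be encoded injectively by elements of `Fin Δ`. -/
lemma exists_neighbor_code (hG : 0 < G.maxDegree) :
    ∃ code : V → V → Fin G.maxDegree, ∀ u v v', G.Adj u v → G.Adj u v' →
      code u v = code u v' → v = v' := by
  classical
  have : ∀ u, ∃ g : V → Fin G.maxDegree, ∀ v v', G.Adj u v → G.Adj u v' →
      g v = g v' → v = v' := by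
    intro u
    have hc : Fintype.card (G.neighborFinset u) ≤ Fintype.card (Fin G.maxDegree) := by
      rw [Fintype.card_coe, Fintype.card_fin]
      exact G.degree_le_maxDegree u
    obtain ⟨g⟩ := Function.Embedding.nonempty_of_card_le hc
    refine ⟨fun v => if h : v ∈ G.neighborFinset u then g ⟨v, h⟩ else ⟨0, hG⟩, ?_⟩
    intro v v' hv hv' h
    have hv := (G.mem_neighborFinset u v).2 hv
    have hv' := (G.mem_neighborFinset u v').2 hv'
    simp only [dif_pos hv, dif_pos hv'] at h
    simpa using g.injective h
  choose code h using this
  exact ⟨code, h⟩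

open Classical in
/-- There are at most `Δ ^ (n - 1)` walks with `n` edges whose `i`-th edge is a given arc. -/
lemma card_walks_through_arc_le (hG : 0 < G.maxDegree) {n : ℕ} (i : Fin n) (u v : V) :
    #{p : Fin (n + 1) → V | (∀ t : Fin n, G.Adj (p t.castSucc) (p t.succ)) ∧
      p i.castSucc = u ∧ p i.succ = v} ≤ G.maxDegree ^ (n - 1) := by
  obtain ⟨code, hcode⟩ := exists_neighbor_code G hG
  have hcard : Fintype.card ({t : Fin n // t ≠ i} → Fin G.maxDegree) =
      G.maxDegree ^ (n - 1) := by
    simp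
  rw [← hcard, ← card_univ]
  refine card_le_card_of_injOn (fun p t => if i < t.1 then code (p t.1.castSucc) (p t.1.succ)
    else code (p t.1.succ) (p t.1.castSucc)) (fun _ _ => mem_coe.2 (mem_univ _)) ?_
  intro p hp q hq h
  simp only [coe_filter, mem_univ, true_and, Set.mem_ofPred_eq] at hp hq
  obtain ⟨hp, hpu, hpv⟩ := hp
  obtain ⟨hq, hqu, hqv⟩ := hq
  have hup : ∀ t : Fin n, i < t → p t.castSucc = q t.castSucc → p t.succ = q t.succ := by
    intro t ht hpq
    have := congrFun h ⟨t, ht.ne'⟩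
    simp only [if_pos ht, hpq] at this
    exact hcode _ _ _ (hpq ▸ hp t) (hq t) this
  have hdown : ∀ t : Fin n, t < i → p t.succ = q t.succ → p t.castSucc = q t.castSucc := by
    intro t ht hpq
    have := congrFun h ⟨t, ht.ne⟩
    simp only [if_neg ht.not_gt, hpq] at this
    exact hcode _ _ _ (hpq ▸ (hp t).symm) (hq t).symm this
  have h1 : ∀ t : ℕ, i.1 + 1 ≤ t → ∀ ht : t < n + 1, p ⟨t, ht⟩ = q ⟨t, ht⟩ := by
    intro t hit
    induction t, hit using Nat.le_induction with
    | base => exact fun _ => hpv.trans hqv.symm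
    | succ t hit IH =>
      intro ht
      exact hup ⟨t, by omega⟩ (Fin.lt_def.2 hit) (IH (by omega))
  have h2 : ∀ d : ℕ, d ≤ i.1 → ∀ ht : i.1 - d < n + 1, p ⟨i.1 - d, ht⟩ = q ⟨i.1 - d, ht⟩ := by
    intro d
    induction d with
    | zero => exact fun _ _ => hpu.trans hqu.symm
    | succ d IH =>
      intro hd ht
      have hlt : i.1 - (d + 1) < n := by omega
      refine hdown ⟨i.1 - (d + 1), hlt⟩ (Fin.lt_def.2 (by simp; omega)) ?_
      have he : (⟨i.1 - (d + 1), hlt⟩ : Fin n).succ = ⟨i.1 - d, by omega⟩ := by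
        ext; simp; omega
      rw [he]
      exact IH (by omega) _
  funext ⟨t, ht⟩
  rcases Nat.lt_or_ge i.1 t with hit | hit
  · exact h1 t hit ht
  · have := h2 (i.1 - t) (by omega) (by omega)
    simpa only [Nat.sub_sub_self hit] using this

open Classical in
/-- The paths of `G` with `n` edges. -/
noncomputable def paths (n : ℕ) : Finset (Fin (n + 1) → V) :=
  {p | (∀ t : Fin n, G.Adj (p t.castSucc) (p t.succ)) ∧ Function.Injective p}

/-- The two halves of the edge sequence of a path with `2 * j + 2` edges. -/
def edgeHalves {j : ℕ} (p : Fin (2 * j + 2 + 1) → V) :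
    (Fin (j + 1) → Sym2 V) × (Fin (j + 1) → Sym2 V) :=
  (fun i => s(p ⟨i, by omega⟩, p ⟨i + 1, by omega⟩),
    fun i => s(p ⟨i + (j + 1), by omega⟩, p ⟨i + (j + 1) + 1, by omega⟩))

open Classical in
/-- The edge sequences of the paths of `G` with `2 * j + 2` edges, split into halves. -/
noncomputable def edgeWords (j : ℕ) : Finset ((Fin (j + 1) → Sym2 V) × (Fin (j + 1) → Sym2 V)) :=
  (paths G (2 * j + 2)).image edgeHalves

lemma mem_edgeWords {j : ℕ} {w : (Fin (j + 1) → Sym2 V) × (Fin (j + 1) → Sym2 V)} :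
    w ∈ edgeWords G j ↔ ∃ p ∈ paths G (2 * j + 2), edgeHalves p = w := by
  simp [edgeWords]

lemma edgeWords_injective {j : ℕ} {w : (Fin (j + 1) → Sym2 V) × (Fin (j + 1) → Sym2 V)}
    (hw : w ∈ edgeWords G j) : Function.Injective w.1 := by
  obtain ⟨p, hp, rfl⟩ := (mem_edgeWords G).1 hw
  simp only [paths, mem_filter, mem_univ, true_and] at hp
  intro a b hab
  exact Fin.ext (edge_injective_of_injective hp.2 (by omega) (by omega) hab)

lemma edgeWords_disjoint {j : ℕ} {w : (Fin (j + 1) → Sym2 V) × (Fin (j + 1) → Sym2 V)}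
    (hw : w ∈ edgeWords G j) (i i' : Fin (j + 1)) : w.1 i ≠ w.2 i' := by
  obtain ⟨p, hp, rfl⟩ := (mem_edgeWords G).1 hw
  simp only [paths, mem_filter, mem_univ, true_and] at hp
  intro h
  have := edge_injective_of_injective hp.2 (by omega) (by omega) h
  omega

lemma edgeWords_rev {j : ℕ} {w : (Fin (j + 1) → Sym2 V) × (Fin (j + 1) → Sym2 V)}
    (hw : w ∈ edgeWords G j) : (w.2 ∘ Fin.rev, w.1 ∘ Fin.rev) ∈ edgeWords G j := by
  obtain ⟨p, hp, rfl⟩ := (mem_edgeWords G).1 hw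
  simp only [paths, mem_filter, mem_univ, true_and] at hp
  refine (mem_edgeWords G).2 ⟨p ∘ Fin.rev, ?_, ?_⟩
  · simp only [paths, mem_filter, mem_univ, true_and]
    refine ⟨fun t => ?_, hp.2.comp Fin.rev_injective⟩
    simpa [Fin.rev_castSucc, Fin.rev_succ] using (hp.1 t.rev).symm
  · refine Prod.ext (funext fun i => ?_) (funext fun i => ?_)
    all_goals
      simp only [edgeHalves, Function.comp_apply]
      rw [Sym2.eq_swap]
      congr 3 <;> ext <;> simp [Fin.val_rev] <;> omega

open Classical in
lemma card_edgeWords_through_le (hG : 0 < G.maxDegree) (j : ℕ) (e : Sym2 V) :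
    #{w ∈ edgeWords G j | ∃ i, w.1 i = e} ≤ 2 * (j + 1) * G.maxDegree ^ (2 * j + 1) := by
  induction e using Sym2.ind with
  | _ u v =>
  let A : V → V → Fin (j + 1) → Finset (Fin (2 * j + 2 + 1) → V) := fun x y i =>
    {p | (∀ t : Fin (2 * j + 2), G.Adj (p t.castSucc) (p t.succ)) ∧
      p (⟨i, by omega⟩ : Fin (2 * j + 2)).castSucc = x ∧
      p (⟨i, by omega⟩ : Fin (2 * j + 2)).succ = y}
  have hA : ∀ x y i, #(A x y i) ≤ G.maxDegree ^ (2 * j + 1) := fun x y i =>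
    card_walks_through_arc_le G hG _ x y
  have hsub : {w ∈ edgeWords G j | ∃ i, w.1 i = s(u, v)} ⊆
      (univ.biUnion fun i => A u v i ∪ A v u i).image edgeHalves := by
    intro w hw
    obtain ⟨hw, i, hi⟩ := mem_filter.1 hw
    obtain ⟨p, hp, rfl⟩ := (mem_edgeWords G).1 hw
    simp only [paths, mem_filter, mem_univ, true_and] at hp
    refine mem_image_of_mem _ (mem_biUnion.2 ⟨i, mem_univ _, ?_⟩)
    simp only [A, mem_union, mem_filter, mem_univ, true_and]
    rcases Sym2.eq_iff.1 hi with h | h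
    · exact Or.inl ⟨hp.1, h⟩
    · exact Or.inr ⟨hp.1, h⟩
  calc _ ≤ _ := (card_le_card hsub).trans (card_image_le.trans card_biUnion_le)
    _ ≤ ∑ _i : Fin (j + 1), 2 * G.maxDegree ^ (2 * j + 1) := by
        refine sum_le_sum fun i _ => (card_union_le _ _).trans ?_
        have := hA u v i
        have := hA v u i
        omega
    _ = _ := by simp; ring

end Paths

lemma sum_succ_mul_pow_le {x : ℝ} (hx0 : 0 ≤ x) (hx1 : x < 1) (n : ℕ) :
    ∑ j ∈ range n, ((j : ℝ) + 1) * x ^ j ≤ 1 / (1 - x) ^ 2 := by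
  have h := hasSum_choose_mul_geometric_of_norm_lt_one 1
    (by rwa [Real.norm_of_nonneg hx0] : ‖x‖ < 1)
  simp only [Nat.choose_one_right] at h
  refine le_trans (le_of_eq ?_) (sum_le_hasSum (range n) (fun j _ => by positivity) h)
  exact sum_congr rfl fun j _ => by push_cast; rfl

/-- Any `k` that exceeds `β + 2Δ / (1 - Δ² / β)²` bounds the Thue choice index. -/
lemma thueChoiceIndex_le {V : Type} [Fintype V] (G : SimpleGraph V) [DecidableRel G.Adj]
    (hG : 0 < G.maxDegree) {β : ℝ} (hβ : (G.maxDegree : ℝ) ^ 2 < β) {k : ℕ}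
    (hk : β + 2 * G.maxDegree / (1 - (G.maxDegree : ℝ) ^ 2 / β) ^ 2 ≤ k) :
    thueChoiceIndex G ≤ k := by
  classical
  have hβ0 : 0 < β := lt_of_le_of_lt (by positivity) hβ
  refine Nat.sInf_le ?_
  intro L hL
  let L' : Sym2 V → Finset ℕ := fun e => if e ∈ G.edgeSet then L e else range k
  have hL' : ∀ e, #(L' e) = k := by
    intro e
    by_cases he : e ∈ G.edgeSet
    · simp only [L', if_pos he, hL e he]
    · simp [L', if_neg he]
  have hsum : β + ∑ j ∈ range (Fintype.card (Sym2 V)),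
      (2 * ((j : ℝ) + 1) * (G.maxDegree : ℝ) ^ (2 * j + 1)) / β ^ j ≤ k := by
    refine le_trans ?_ hk
    have := sum_succ_mul_pow_le (x := (G.maxDegree : ℝ) ^ 2 / β) (by positivity)
      ((div_lt_one hβ0).2 hβ) (Fintype.card (Sym2 V))
    have h2 := mul_le_mul_of_nonneg_left this (by positivity : 0 ≤ 2 * (G.maxDegree : ℝ))
    rw [mul_sum, mul_one_div] at h2
    refine add_le_add_right (le_trans (le_of_eq ?_) h2) β
    refine sum_congr rfl fun j _ => ?_
    rw [div_pow, ← pow_mul]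
    ring
  obtain ⟨f, hf, hfree⟩ := exists_free_coloring (W := edgeWords G) (L := L') hβ0 hL'
    (fun j w hw => edgeWords_injective G hw) (fun j w hw => edgeWords_disjoint G hw)
    (fun j w hw => edgeWords_rev G hw)
    (N := fun j => 2 * ((j : ℝ) + 1) * (G.maxDegree : ℝ) ^ (2 * j + 1))
    (fun j e => by exact_mod_cast card_edgeWords_through_le G hG j e) hsum
  refine ⟨f, fun e he => by simpa only [L', if_pos he] using hf e, ?_⟩
  intro j hj p hadj hp
  obtain ⟨m, rfl⟩ : ∃ m, j = m + 1 := ⟨j - 1, by omega⟩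
  have hmem : edgeHalves (j := m) (fun t => p t) ∈ edgeWords G m := by
    refine (mem_edgeWords G).2 ⟨_, ?_, rfl⟩
    simp only [paths, mem_filter, mem_univ, true_and]
    refine ⟨fun t => hadj t (by omega), fun a b hab => ?_⟩
    by_contra hne
    exact hp a b (by omega) (by omega) (fun h => hne (Fin.ext h)) hab
  obtain ⟨i, hi⟩ := hfree m _ hmem
  exact ⟨i, i.2, hi⟩

end ThueChoice

theorem stmt6 :
    ∃ C : ℝ, 0 < C ∧
      ∀ (V : Type) [Fintype V] (G : SimpleGraph V) [DecidableRel G.Adj],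
        3 ≤ G.maxDegree →
        (thueChoiceIndex G : ℝ) ≤
          (G.maxDegree : ℝ) ^ 2 + (2 : ℝ) ^ ((4 : ℝ) / 3) * (G.maxDegree : ℝ) ^ ((5 : ℝ) / 3)
            + C * (G.maxDegree : ℝ) ^ ((4 : ℝ) / 3) := by
  refine ⟨5, by norm_num, fun V _ G _ hG => ?_⟩
  have hD : (1 : ℝ) ≤ G.maxDegree := by exact_mod_cast (by omega : 1 ≤ G.maxDegree)
  obtain ⟨r, hr⟩ : ∃ r : ℝ, r = (G.maxDegree : ℝ) ^ ((1 : ℝ) / 3) := ⟨_, rfl⟩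
  have hr1 : 1 ≤ r := hr ▸ Real.one_le_rpow hD (by norm_num)
  have hrpow : ∀ n : ℕ, r ^ n = (G.maxDegree : ℝ) ^ ((n : ℝ) / 3) := by
    intro n
    rw [hr, ← Real.rpow_natCast, ← Real.rpow_mul (by linarith)]
    congr 1
    ring
  have h3 : (G.maxDegree : ℝ) = r ^ 3 := by simp [hrpow]
  have h4 := hrpow 4
  have h5 := hrpow 5
  push_cast at h4 h5
  rw [← h4, ← h5]
  have h2 : (5 : ℝ) / 2 ≤ (2 : ℝ) ^ ((4 : ℝ) / 3) := by
    refine le_of_pow_le_pow_left₀ (n := 3) (by norm_num) (by positivity) ?_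
    rw [← Real.rpow_natCast, ← Real.rpow_natCast, ← Real.rpow_mul (by norm_num)]
    norm_num
  have hval : r ^ 6 + 2 * r ^ 5 + 2 * (G.maxDegree : ℝ) /
      (1 - (G.maxDegree : ℝ) ^ 2 / (r ^ 6 + 2 * r ^ 5)) ^ 2 =
      r ^ 6 + 5 / 2 * r ^ 5 + 2 * r ^ 4 + 2 * r ^ 3 := by
    have h0 : r ≠ 0 := by positivity
    have h0' : r + 2 ≠ 0 := by positivity
    have : 1 - (G.maxDegree : ℝ) ^ 2 / (r ^ 6 + 2 * r ^ 5) = 2 / (r + 2) := by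
      have h00 : r ^ 6 + 2 * r ^ 5 ≠ 0 := by positivity
      rw [h3]
      field_simp
      ring
    rw [this, h3]
    field_simp
    ring
  have hβ : (G.maxDegree : ℝ) ^ 2 < r ^ 6 + 2 * r ^ 5 := by
    have : 0 < r ^ 5 := by positivity
    rw [h3]
    nlinarith
  have hle := ThueChoice.thueChoiceIndex_le G (by omega) hβ (Nat.le_ceil _)
  have hle' : (thueChoiceIndex G : ℝ) ≤ r ^ 6 + 5 / 2 * r ^ 5 + 2 * r ^ 4 + 2 * r ^ 3 + 1 := by
    refine (Nat.cast_le.2 hle).trans ?_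
    rw [hval]
    exact (Nat.ceil_lt_add_one (by positivity)).le
  have h34 : r ^ 3 ≤ r ^ 4 := pow_le_pow_right₀ hr1 (by norm_num)
  have h14 : 1 ≤ r ^ 4 := one_le_pow₀ hr1
  have h55 := mul_le_mul_of_nonneg_right h2 (by positivity : 0 ≤ r ^ 5)
  have h6 : (G.maxDegree : ℝ) ^ 2 = r ^ 6 := by rw [h3]; ring
  rw [h6]
  linarith
end
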